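/- For every real number B, the set of subfields K of ℂ such that K is a number field, K is not a CM field, and the regulator R_K of K satisfies R_K ≤ B, is finite. -/

import Mathlib

/-- A CM field is a totally imaginary quadratic extension of a totally real field:
`K` has no real embeddings and contains a subfield `K₀` all of whose complex embeddings
are real such that `[K : K₀] = 2`. -/
def IsCMField (K : Type*) [Field K] : Prop :=
  (∀ φ : K →+* ℂ, ¬ NumberField.ComplexEmbedding.IsReal φ) ∧
  ∃ K₀ : Subfield K, (∀ φ : K₀ →+* ℂ, NumberField.ComplexEmbedding.IsReal φ) ∧
    Module.finrank K₀ K = 2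

section part1

open MeasureTheory Module
set_option linter.unusedSectionVars false

section theta
variable {V : Type*} [NormedAddCommGroup V] [NormedSpace ℝ V] [FiniteDimensional ℝ V]
  [MeasurableSpace V] [BorelSpace V]

/-- Gaussian attached to a function `q`. -/
noncomputable def gss (q : V → ℝ) (A : ℝ) (x : V) : ENNReal := ENNReal.ofReal (Real.exp (-(A * q x)))

lemma measurable_gss {q : V → ℝ} (hq : Measurable q) (A : ℝ) : Measurable (gss q A) := by
  unfold gss; fun_prop

lemma ennreal_two_mul_le (a b : ENNReal) : 2 * (a * b) ≤ a * a + b * b := by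
  have key : ∀ a b : ENNReal, a ≤ b → 2 * (a * b) ≤ a * a + b * b := by
    intro a b hab
    obtain ⟨c, rfl⟩ := exists_add_of_le hab
    have : a * a + (a + c) * (a + c) = 2 * (a * (a + c)) + c * c := by ring
    rw [this]; exact le_self_add
  rcases le_total a b with h | h
  · exact key a b h
  · rw [mul_comm a b, add_comm]; exact key b a h

lemma gss_unfold (μ : Measure V) [μ.IsAddHaarMeasure] (L : AddSubgroup V) [Countable L]
    {F : Set V} (hF : IsAddFundamentalDomain L F μ) {h G : V → ENNReal}
    (hh : Measurable h) (hG : Measurable G)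
    (hper : ∀ v : L, ∀ x, G ((v : V) + x) = G x) :
    ∫⁻ x in F, (∑' v : L, h ((v : V) + x)) * G x ∂μ = ∫⁻ x, h x * G x ∂μ := by
  rw [hF.lintegral_eq_tsum'' (fun x => h x * G x)]
  simp_rw [← ENNReal.tsum_mul_right]
  rw [lintegral_tsum]
  · refine tsum_congr fun v => ?_
    refine lintegral_congr fun x => ?_
    simp only [AddSubgroup.vadd_def, vadd_eq_add]
    rw [hper]
  · intro v
    have : Measurable fun x => h ((v : V) + x) * G x := by fun_prop
    exact this.aemeasurable

lemma gss_mul {q : V → ℝ} 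
    (h2 : ∀ A B : ℝ, 0 < A → 0 < B → ∀ u v, A * q u + B * q (u + v) =
      (A + B) * q (u + (B / (A + B)) • v) + A * B / (A + B) * q v)
    {A B : ℝ} (hA : 0 < A) (hB : 0 < B) (u v : V) :
    gss q A u * gss q B (u + v) = gss q (A + B) (u + (B / (A + B)) • v) * gss q (A * B / (A + B)) v := by
  unfold gss
  rw [← ENNReal.ofReal_mul (by positivity), ← ENNReal.ofReal_mul (by positivity), ← Real.exp_add,
    ← Real.exp_add, ← neg_add, ← neg_add, h2 A B hA hB]

lemma lintegral_gss_mul (μ : Measure V) [μ.IsAddHaarMeasure] {q : V → ℝ} (hq : Measurable q)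
    (h2 : ∀ A B : ℝ, 0 < A → 0 < B → ∀ u v, A * q u + B * q (u + v) =
      (A + B) * q (u + (B / (A + B)) • v) + A * B / (A + B) * q v)
    {A B : ℝ} (hA : 0 < A) (hB : 0 < B) (v : V) :
    ∫⁻ u, gss q A u * gss q B (u + v) ∂μ = (∫⁻ u, gss q (A + B) u ∂μ) * gss q (A * B / (A + B)) v := by
  simp_rw [gss_mul h2 hA hB]
  rw [lintegral_mul_const _ (by have := measurable_gss hq (A+B); fun_prop)]
  congr 1
  exact lintegral_add_right_eq_self (gss q (A + B)) _

lemma theta_shift (μ : Measure V) [μ.IsAddHaarMeasure] (L : AddSubgroup V) [Countable L]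
    {F : Set V} (hF : IsAddFundamentalDomain L F μ) {q : V → ℝ} (hq : Measurable q)
    (h2 : ∀ A B : ℝ, 0 < A → 0 < B → ∀ u v, A * q u + B * q (u + v) =
      (A + B) * q (u + (B / (A + B)) • v) + A * B / (A + B) * q v)
    (hI : ∀ A : ℝ, 0 < A → ∫⁻ x, gss q A x ∂μ ≠ ⊤) (hI0 : ∀ A : ℝ, 0 < A → ∫⁻ x, gss q A x ∂μ ≠ 0)
    {B : ℝ} (hB : 0 < B) (u : V) :
    ∑' v : L, gss q B (u + v) ≤ ∑' v : L, gss q B v := by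
  set h := gss q (2 * B) with hh
  have hm : Measurable h := measurable_gss hq _
  set P : V → ENNReal := fun x => ∑' v : L, h ((v : V) + x) with hP
  have hPm : Measurable P := by
    apply Measurable.tsum
    intro v; fun_prop
  have hper : ∀ v : L, ∀ x, P ((v : V) + x) = P x := by
    intro v x
    simp only [hP]
    rw [← (Equiv.addRight v).tsum_eq (fun w : L => h ((w : V) + x))]
    refine tsum_congr fun w => ?_
    simp [add_assoc]
  have key : ∀ y : V, ∫⁻ x in F, P x * P (x + y) ∂μ
      = (∫⁻ u, gss q (4 * B) u ∂μ) * ∑' v : L, gss q B (y + v) := by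
    intro y
    rw [gss_unfold μ L hF hm (G := fun x => P (x + y)) (by fun_prop)
      (fun v x => by simp only [add_assoc]; exact hper _ _)]
    simp only [hP, ← ENNReal.tsum_mul_left]
    rw [lintegral_tsum (fun v => by
      have : Measurable fun x => h x * h ((v : V) + (x + y)) := by fun_prop
      exact this.aemeasurable)]
    refine tsum_congr fun v => ?_
    have := lintegral_gss_mul μ hq h2 (A := 2 * B) (B := 2 * B) (by positivity) (by positivity) (y + v)
    rw [show 2 * B + 2 * B = 4 * B by ring, show 2 * B * (2 * B) / (4 * B) = B by field_simp; norm_num] at this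
    rw [← this]
    refine lintegral_congr fun x => ?_
    rw [hh]; congr 2; abel
  have k2 : ∫⁻ x in F, P (x + u) * P (x + u) ∂μ = ∫⁻ x in F, P x * P (x + 0) ∂μ := by
    have e1 := gss_unfold μ L hF (h := fun x => h (x + u)) (by fun_prop) (G := fun x => P (x + u)) (by fun_prop)
      (fun v x => by simp only [add_assoc]; exact hper _ _)
    have e2 := gss_unfold μ L hF hm (G := P) (by fun_prop) hper
    simp only [add_zero]
    rw [e2, ← lintegral_add_right_eq_self (fun x => h x * P x) u, ← e1]
    simp only [hP, add_assoc]
  have k3 : 2 * ∫⁻ x in F, P x * P (x + u) ∂μ ≤ 2 * ∫⁻ x in F, P x * P (x + 0) ∂μ := by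
    calc 2 * ∫⁻ x in F, P x * P (x + u) ∂μ = ∫⁻ x in F, 2 * (P x * P (x + u)) ∂μ := by
          rw [lintegral_const_mul _ (by fun_prop)]
      _ ≤ ∫⁻ x in F, (P x * P x + P (x + u) * P (x + u)) ∂μ := by
          refine lintegral_mono fun x => ?_
          exact ennreal_two_mul_le _ _
      _ = _ := by
          rw [lintegral_add_left (by fun_prop), k2]
          simp [two_mul]
  rw [key, key] at k3
  rw [ENNReal.mul_le_mul_iff_right (by simp) (by simp), 
    ENNReal.mul_le_mul_iff_right (hI0 _ (by positivity)) (hI _ (by positivity))] at k3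
  simpa using k3

/-- Monotonicity of `s ^ n Θ(s)`. -/
lemma theta_mono (μ : Measure V) [μ.IsAddHaarMeasure] (L : AddSubgroup V) [Countable L]
    {F : Set V} (hF : IsAddFundamentalDomain L F μ) {q : V → ℝ} (hq : Measurable q)
    (h2 : ∀ A B : ℝ, 0 < A → 0 < B → ∀ u v, A * q u + B * q (u + v) =
      (A + B) * q (u + (B / (A + B)) • v) + A * B / (A + B) * q v)
    (hs : ∀ (c : ℝ) x, q (c • x) = c ^ 2 * q x)
    (hI : ∀ A : ℝ, 0 < A → ∫⁻ x, gss q A x ∂μ ≠ ⊤) (hI0 : ∀ A : ℝ, 0 < A → ∫⁻ x, gss q A x ∂μ ≠ 0)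
    {s : ℝ} (h1s : 1 < s) :
    ∑' v : L, gss q 1 v ≤ ENNReal.ofReal (s ^ finrank ℝ V) * ∑' v : L, gss q (s ^ 2) v := by
  have hs1 : 0 < s ^ 2 - 1 := by nlinarith
  set A := s ^ 2 / (s ^ 2 - 1) with hA
  have hA0 : 0 < A := by positivity
  have e1 : A + s ^ 2 = s ^ 2 * A := by rw [hA]; field_simp; ring
  have e2 : A * s ^ 2 / (A + s ^ 2) = 1 := by rw [e1, mul_comm]; field_simp
  have hsc : ∫⁻ x, gss q A x ∂μ = ENNReal.ofReal (s ^ finrank ℝ V) * ∫⁻ x, gss q (A + s ^ 2) x ∂μ := by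
    have : ∀ x, gss q (A + s ^ 2) x = gss q A (s • x) := by
      intro x; unfold gss; rw [hs, e1]; ring_nf
    simp_rw [this]
    rw [← lintegral_map (μ := μ) (f := gss q A) (g := fun x => s • x) (measurable_gss hq _) (by fun_prop),
      Measure.map_addHaar_smul μ (by positivity), lintegral_smul_measure, smul_eq_mul, ← mul_assoc,
      ← ENNReal.ofReal_mul (by positivity), abs_of_nonneg (by positivity), mul_inv_cancel₀ (by positivity)]
    simp
  have main : (∫⁻ x, gss q (A + s ^ 2) x ∂μ) * ∑' v : L, gss q 1 v ≤
     (∫⁻ x, gss q A x ∂μ) *  ∑' v : L, gss q (s ^ 2) v := by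
    rw [← ENNReal.tsum_mul_left]
    have : ∀ v : L, (∫⁻ x, gss q (A + s ^ 2) x ∂μ) * gss q 1 v = ∫⁻ u, gss q A u * gss q (s ^ 2) (u + v) ∂μ := by
      intro v
      rw [lintegral_gss_mul μ hq h2 hA0 (by positivity), e2]
    simp_rw [this]
    have m1 := measurable_gss hq A
    have m2 := measurable_gss hq (s^2)
    rw [← lintegral_tsum (fun v => by
      have : Measurable fun u => gss q A u * gss q (s ^ 2) (u + v) := by fun_prop
      exact this.aemeasurable)]
    simp_rw [ENNReal.tsum_mul_left]
    rw [← lintegral_mul_const _ m1]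
    refine lintegral_mono fun u => ?_
    refine mul_le_mul_right ?_ _
    exact theta_shift μ L hF hq h2 hI hI0 (by positivity) u
  rw [hsc, mul_assoc, mul_left_comm, ENNReal.mul_le_mul_iff_right (hI0 _ (by positivity)) (hI _ (by positivity))] at main
  exact main
end theta

end part1

section part2

open MeasureTheory Module
set_option linter.unusedSectionVars false
set_option linter.unusedSimpArgs false
open NumberField NumberField.InfinitePlace NumberField.mixedEmbedding

section mix
open scoped Classical
variable (K : Type*) [Field K] [NumberField K]

/-- the standard quadratic form -/
noncomputable def qf (x : mixedSpace K) : ℝ := ∑ w, normAtPlace w x ^ 2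

noncomputable def Mt (s : ℝ) : ℝ :=
  Real.Gamma (s / 2) ^ nrRealPlaces K * (Real.pi * Real.Gamma s) ^ nrComplexPlaces K

variable {K}

lemma prod_places {M : Type*} [CommMonoid M] (f : InfinitePlace K → M) :
    ∏ w, f w = (∏ w : {w : InfinitePlace K // IsReal w}, f w.1) *
      ∏ w : {w : InfinitePlace K // IsComplex w}, f w.1 := by
  rw [← Fintype.prod_subtype_mul_prod_subtype (fun w : InfinitePlace K => IsReal w)]
  congr 1
  exact Fintype.prod_equiv (Equiv.subtypeEquivRight fun w : InfinitePlace K => not_isReal_iff_isComplex) _ _ (fun _ => rfl)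

lemma continuous_qf : Continuous (qf K) := by
  unfold qf
  exact continuous_finsetSum _ fun w _ => (continuous_normAtPlace w).pow 2

lemma real_gauss {b s : ℝ} (hb : 0 < b) (hs : 0 < s) :
    ∫ x : ℝ, |x| ^ (s - 1) * Real.exp (-(b * |x|) ^ 2) = b ^ (-s) * Real.Gamma (s / 2) ∧
    Integrable (fun x : ℝ => |x| ^ (s - 1) * Real.exp (-(b * |x|) ^ 2)) := by
  have h := integral_rpow_mul_exp_neg_mul_rpow (p := 2) (q := s - 1) (b := b ^ 2) (by norm_num) (by linarith) (by positivity)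
  have e : ∫ x : ℝ, |x| ^ (s - 1) * Real.exp (-(b * |x|) ^ 2) = b ^ (-s) * Real.Gamma (s / 2) := by
    rw [integral_comp_abs (f := fun x : ℝ => x ^ (s - 1) * Real.exp (-(b * x) ^ 2))]
    have : ∀ x : ℝ, x ^ (s - 1) * Real.exp (-(b * x) ^ 2) = x ^ (s - 1) * Real.exp (-b ^ 2 * x ^ (2:ℝ)) := by
      intro x; rw [Real.rpow_two]; ring_nf
    simp_rw [this, h]
    rw [← Real.rpow_natCast b 2, ← Real.rpow_mul hb.le]
    rw [show ((2:ℕ):ℝ) * (-(s - 1 + 1) / 2) = -s by push_cast; ring, show (s - 1 + 1) / 2 = s / 2 by ring]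
    ring
  refine ⟨e, ?_⟩
  by_contra hn
  rw [integral_undef hn] at e
  have := Real.Gamma_pos_of_pos (half_pos hs)
  have : 0 < b ^ (-s) * Real.Gamma (s / 2) := by positivity
  linarith

lemma complex_gauss {b s : ℝ} (hb : 0 < b) (hs : 0 < s) :
    ∫ x : ℂ, (‖x‖ ^ 2) ^ (s - 1) * Real.exp (-(b * ‖x‖) ^ 2) = (b ^ 2) ^ (-s) * (Real.pi * Real.Gamma s) ∧
    Integrable (fun x : ℂ => (‖x‖ ^ 2) ^ (s - 1) * Real.exp (-(b * ‖x‖) ^ 2)) := by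
  have h := Complex.integral_rpow_mul_exp_neg_mul_rpow (p := 2) (q := 2 * (s - 1)) (b := b ^ 2) (by norm_num) (by linarith) (by positivity)
  have e : ∫ x : ℂ, (‖x‖ ^ 2) ^ (s - 1) * Real.exp (-(b * ‖x‖) ^ 2) = (b ^ 2) ^ (-s) * (Real.pi * Real.Gamma s) := by
    have : ∀ x : ℂ, (‖x‖ ^ 2) ^ (s - 1) * Real.exp (-(b * ‖x‖) ^ 2) = ‖x‖ ^ (2 * (s - 1)) * Real.exp (-b ^ 2 * ‖x‖ ^ (2:ℝ)) := by
      intro x; rw [Real.rpow_two, Real.rpow_mul (norm_nonneg _), Real.rpow_two]; ring_nf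
    simp_rw [this, h]
    rw [show  (-(2 * (s - 1) + 2) / 2) = -s by ring, show (2 * (s - 1) + 2) / 2 = s by ring]
    ring
  refine ⟨e, ?_⟩
  by_contra hn
  rw [integral_undef hn] at e
  have := Real.Gamma_pos_of_pos hs
  have : 0 < (b ^ 2) ^ (-s) * (Real.pi * Real.Gamma s) := by positivity
  linarith

/-- real part of the Gaussian integrand -/
noncomputable def fR (K : Type*) [Field K] [NumberField K] (y : mixedSpace K) (s : ℝ)
    (x : {w : InfinitePlace K // IsReal w} → ℝ) : ℝ := ∏ w,
    (|x w| ^ (s - 1) * Real.exp (-(normAtPlace w.1 y * |x w|) ^ 2))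

/-- complex part of the Gaussian integrand -/
noncomputable def fC (K : Type*) [Field K] [NumberField K] (y : mixedSpace K) (s : ℝ)
    (x : {w : InfinitePlace K // IsComplex w} → ℂ) : ℝ := ∏ w,
    ((‖x w‖ ^ 2) ^ (s - 1) * Real.exp (-(normAtPlace w.1 y * ‖x w‖) ^ 2))

lemma fR_int (y : mixedSpace K) (hb : ∀ w, 0 < normAtPlace w y) {s : ℝ} (hs : 0 < s) :
    Integrable (fR K y s) ∧ ∫ x, fR K y s x =
      ∏ w : {w : InfinitePlace K // IsReal w}, (normAtPlace w.1 y ^ (-s) * Real.Gamma (s / 2)) := by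
  constructor
  · exact Integrable.fintype_prod (f := fun (w : {w : InfinitePlace K // IsReal w}) (x : ℝ) => |x| ^ (s - 1) * Real.exp (-(normAtPlace w.1 y * |x|) ^ 2))
     (fun w => (real_gauss (hb w.1) hs).2)
  · unfold fR
    rw [integral_fintype_prod_volume_eq_prod (fun (w : {w : InfinitePlace K // IsReal w}) (x : ℝ) => |x| ^ (s - 1) * Real.exp (-(normAtPlace w.1 y * |x|) ^ 2))]
    exact Finset.prod_congr rfl fun w _ => (real_gauss (hb w.1) hs).1

lemma fC_int (y : mixedSpace K) (hb : ∀ w, 0 < normAtPlace w y) {s : ℝ} (hs : 0 < s) :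
    Integrable (fC K y s) ∧ ∫ x, fC K y s x =
      ∏ w : {w : InfinitePlace K // IsComplex w}, ((normAtPlace w.1 y ^ 2) ^ (-s) * (Real.pi * Real.Gamma s)) := by
  constructor
  · exact Integrable.fintype_prod (f := fun (w : {w : InfinitePlace K // IsComplex w}) (x : ℂ) => (‖x‖ ^ 2) ^ (s - 1) * Real.exp (-(normAtPlace w.1 y * ‖x‖) ^ 2))
     (fun w => (complex_gauss (hb w.1) hs).2)
  · unfold fC
    rw [integral_fintype_prod_volume_eq_prod (fun (w : {w : InfinitePlace K // IsComplex w}) (x : ℂ) => (‖x‖ ^ 2) ^ (s - 1) * Real.exp (-(normAtPlace w.1 y * ‖x‖) ^ 2))]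
    exact Finset.prod_congr rfl fun w _ => (complex_gauss (hb w.1) hs).1

lemma fRC_eq (y x : mixedSpace K) (s : ℝ) :
    mixedEmbedding.norm x ^ (s - 1) * Real.exp (-qf K (y * x)) = fR K y s x.1 * fC K y s x.2 := by
  rw [fR, fC, qf, mixedEmbedding.norm_apply, ← Finset.sum_neg_distrib, Real.exp_sum, ← Real.finsetProd_rpow _ _ (fun w _ => by
      have := normAtPlace_nonneg w x; positivity), ← Finset.prod_mul_distrib, prod_places]
  congr 1
  · refine Finset.prod_congr rfl fun w _ => ?_
    rw [map_mul, normAtPlace_apply_of_isReal w.2 x, mult_isReal, pow_one, Real.norm_eq_abs]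
  · refine Finset.prod_congr rfl fun w _ => ?_
    rw [map_mul, normAtPlace_apply_of_isComplex w.2 x, mult_isComplex]

lemma prod_Mt (y : mixedSpace K) (hb : ∀ w, 0 < normAtPlace w y) (s : ℝ) :
    (∏ w : {w : InfinitePlace K // IsReal w}, (normAtPlace w.1 y ^ (-s) * Real.Gamma (s / 2))) *
    (∏ w : {w : InfinitePlace K // IsComplex w}, ((normAtPlace w.1 y ^ 2) ^ (-s) * (Real.pi * Real.Gamma s)))
    = mixedEmbedding.norm y ^ (-s) * Mt K s := by
  rw [Mt, mixedEmbedding.norm_apply, ← Real.finsetProd_rpow _ _ (fun w _ => by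
      have := hb w; positivity), prod_places, Finset.prod_mul_distrib, Finset.prod_mul_distrib]
  simp only [mult_isReal, mult_isComplex, Finset.prod_const, Finset.card_univ, pow_one]
  rw [show Fintype.card {w : InfinitePlace K // w.IsReal} = nrRealPlaces K from rfl,
      show Fintype.card {w : InfinitePlace K // w.IsComplex} = nrComplexPlaces K from rfl]
  generalize (∏ w : {w : InfinitePlace K // IsReal w}, normAtPlace w.1 y ^ (-s)) = a
  generalize (∏ w : {w : InfinitePlace K // IsComplex w}, (normAtPlace w.1 y ^ 2) ^ (-s)) = b
  ring

lemma lintegral_gauss (y : mixedSpace K) (hy : mixedEmbedding.norm y ≠ 0) {s : ℝ} (hs : 0 < s) :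
    ∫⁻ x : mixedSpace K, ENNReal.ofReal (mixedEmbedding.norm x ^ (s - 1) * Real.exp (-qf K (y * x)))
      = ENNReal.ofReal (mixedEmbedding.norm y ^ (-s) * Mt K s) := by
  have hb : ∀ w, 0 < normAtPlace w y := fun w => lt_of_le_of_ne (normAtPlace_nonneg _ _)
    (mixedEmbedding.norm_ne_zero_iff.mp hy w).symm
  simp_rw [fRC_eq]
  rw [← ofReal_integral_eq_lintegral_ofReal]
  · rw [← prod_Mt y hb, ← (fR_int y hb hs).2, ← (fC_int y hb hs).2]
    congr 1
    exact integral_prod_mul (fR K y s) (fC K y s)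
  · exact Integrable.mul_prod (fR_int y hb hs).1 (fC_int y hb hs).1
  · refine Filter.Eventually.of_forall fun x => ?_
    simp only [Pi.zero_apply]
    rw [← fRC_eq]
    have := mixedEmbedding.norm_nonneg x
    positivity

lemma qf_h2 (y : mixedSpace K) : ∀ A B : ℝ, 0 < A → 0 < B → ∀ u v, A * qf K (y * u) + B * qf K (y * (u + v)) =
      (A + B) * qf K (y * (u + (B / (A + B)) • v)) + A * B / (A + B) * qf K (y * v) := by
  intro A B hA hB u v
  simp only [qf, Finset.mul_sum, ← Finset.sum_add_distrib]
  refine Finset.sum_congr rfl fun w _ => ?_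
  have hAB : A + B ≠ 0 := by positivity
  rcases w.isReal_or_isComplex with hw | hw
  · simp only [map_mul, mul_pow]
    simp only [normAtPlace_apply_of_isReal hw, Real.norm_eq_abs, mul_pow, sq_abs, Prod.fst_add, Prod.smul_fst, Pi.add_apply, Pi.smul_apply, smul_eq_mul]
    field_simp
    ring
  · simp only [map_mul, mul_pow]
    simp only [normAtPlace_apply_of_isComplex hw, mul_pow, Complex.sq_norm, Complex.normSq_apply, Prod.snd_add, Prod.smul_snd, Pi.add_apply, Pi.smul_apply, Complex.add_re, Complex.add_im, Complex.smul_re, Complex.smul_im, smul_eq_mul]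
    field_simp
    ring

lemma qf_smul (c : ℝ) (x : mixedSpace K) : qf K (c • x) = c ^ 2 * qf K x := by
  simp only [qf, normAtPlace_smul, mul_pow, sq_abs, Finset.mul_sum]

lemma Mt_pos {s : ℝ} (hs : 0 < s) : 0 < Mt K s := by
  have := Real.Gamma_pos_of_pos hs
  have := Real.Gamma_pos_of_pos (half_pos hs)
  have := Real.pi_pos
  unfold Mt; positivity

end mix

end part2

section part3

open MeasureTheory Module
set_option linter.unusedSectionVars false
set_option linter.unusedSimpArgs false
open NumberField NumberField.InfinitePlace NumberField.mixedEmbedding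

section mix3
open scoped Classical
variable {K : Type*} [Field K] [NumberField K]

lemma lintegral_gauss_one (y : mixedSpace K) (hy : mixedEmbedding.norm y ≠ 0) :
    ∫⁻ x : mixedSpace K, ENNReal.ofReal (Real.exp (-qf K (y * x)))
      = ENNReal.ofReal ((mixedEmbedding.norm y)⁻¹ * Mt K 1) := by
  have := lintegral_gauss y hy (s := 1) one_pos
  simpa [Real.rpow_neg_one] using this

lemma mp_unit (u : (𝓞 K)ˣ) :
    MeasurePreserving (fun x : mixedSpace K => u • x) volume volume := by
  let f : mixedSpace K →ₗ[ℝ] mixedSpace K := LinearMap.mulLeft ℝ (mixedEmbedding K (u : 𝓞 K))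
  let g : mixedSpace K →ₗ[ℝ] mixedSpace K := LinearMap.mulLeft ℝ (mixedEmbedding K ((u⁻¹ : (𝓞 K)ˣ) : 𝓞 K))
  have hfg : f ∘ₗ g = LinearMap.id := by
    refine LinearMap.ext fun x => ?_
    change u • u⁻¹ • x = x
    exact smul_inv_smul u x
  have hdet : LinearMap.det f ≠ 0 := by
    intro h
    have := congrArg LinearMap.det hfg
    rw [LinearMap.det_comp, h] at this
    simp at this
  have hm := Measure.map_linearMap_addHaar_eq_smul_addHaar (volume : Measure (mixedSpace K)) hdet
  have hmeas : Measurable f := f.continuous_of_finiteDimensional.measurable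
  refine ⟨hmeas, ?_⟩
  have h1 := lintegral_gauss_one (mixedEmbedding K (u : 𝓞 K)) (by rw [norm_unit]; exact one_ne_zero)
  have h2 := lintegral_gauss_one (1 : mixedSpace K) (by simp)
  have hgm : Measurable fun x : mixedSpace K => ENNReal.ofReal (Real.exp (-qf K x)) := by
    have := (continuous_qf (K := K)).measurable
    fun_prop
  have h3 : ∫⁻ x, ENNReal.ofReal (Real.exp (-qf K x)) ∂(Measure.map f volume) =
    ∫⁻ x : mixedSpace K, ENNReal.ofReal (Real.exp (-qf K (mixedEmbedding K (u : 𝓞 K) * x))) := by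
    rw [lintegral_map hgm hmeas]
    rfl
  rw [hm, lintegral_smul_measure, h1, norm_unit] at h3
  simp only [one_mul] at h2
  rw [h2] at h3
  simp only [map_one] at h3
  have hp : 0 < ((1:ℝ)⁻¹ * Mt K 1) := by have := Mt_pos (K := K) one_pos; simpa
  have h4 : ENNReal.ofReal |(LinearMap.det f)⁻¹| = 1 := by
    have h5 : ENNReal.ofReal |(LinearMap.det f)⁻¹| * ENNReal.ofReal ((1:ℝ)⁻¹ * Mt K 1) = 1 * ENNReal.ofReal ((1:ℝ)⁻¹ * Mt K 1) := by
      rw [one_mul]; exact h3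
    exact (ENNReal.mul_left_inj (by simpa using hp) ENNReal.ofReal_ne_top).mp h5
  rw [h4, one_smul] at hm
  exact hm

lemma theta_mixed (x : mixedSpace K) (hx : mixedEmbedding.norm x ≠ 0) {s : ℝ} (hs : 1 < s) :
    ∑' a : 𝓞 K, ENNReal.ofReal (Real.exp (-qf K (mixedEmbedding K a * x))) ≤
    ENNReal.ofReal (s ^ finrank ℚ K) * 
    ∑' a : 𝓞 K, ENNReal.ofReal (Real.exp (-qf K (mixedEmbedding K a * (s • x)))) := by
  let L : AddSubgroup (mixedSpace K) := (mixedEmbedding.integerLattice K).toAddSubgroup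
  have hF : IsAddFundamentalDomain L (ZSpan.fundamentalDomain (latticeBasis K)) (volume : Measure (mixedSpace K)) :=
    fundamentalDomain_integerLattice K
  have : Countable L := inferInstanceAs (Countable (mixedEmbedding.integerLattice K))
  have hI : ∀ A : ℝ, 0 < A → ∫⁻ u, gss (fun u => qf K (x * u)) A u = ENNReal.ofReal ((mixedEmbedding.norm (Real.sqrt A • x))⁻¹ * Mt K 1) := by
    intro A hA
    have hs : Real.sqrt A ≠ 0 := (Real.sqrt_pos.mpr hA).ne'
    rw [← lintegral_gauss_one]
    · refine lintegral_congr fun u => ?_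
      simp only [gss]
      rw [smul_mul_assoc, qf_smul, Real.sq_sqrt hA.le]
    · rw [mixedEmbedding.norm_smul]
      simp [hx, hs]
  have h := theta_mono (volume : Measure (mixedSpace K)) L hF
    (q := fun u => qf K (x * u)) ((continuous_qf.comp (continuous_const.mul continuous_id)).measurable)
    (qf_h2 x) (fun c u => by rw [mul_smul_comm, qf_smul])
    (fun A hA => by rw [hI A hA]; exact ENNReal.ofReal_ne_top)
    (fun A hA => by
      rw [hI A hA]
      have hs : Real.sqrt A ≠ 0 := (Real.sqrt_pos.mpr hA).ne'
      have : mixedEmbedding.norm (Real.sqrt A • x) ≠ 0 := by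
        rw [mixedEmbedding.norm_smul]; simp [hx, hs]
      have h0 := mixedEmbedding.norm_nonneg (Real.sqrt A • x)
      have := lt_of_le_of_ne h0 this.symm
      have := Mt_pos (K := K) one_pos
      simp only [ne_eq, ENNReal.ofReal_eq_zero, not_le]; positivity) hs
  have key : ∀ f : mixedSpace K → ENNReal, ∑' v : L, f v = ∑' a : 𝓞 K, f (mixedEmbedding K a) := by
    intro f
    let e : 𝓞 K ≃ L := Equiv.ofBijective (fun a => ⟨mixedEmbedding K a, ⟨a, rfl⟩⟩) (by
      refine ⟨fun a b hab => ?_, fun v => ?_⟩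
      · have := congrArg Subtype.val hab
        exact RingOfIntegers.ext (mixedEmbedding_injective K this)
      · obtain ⟨v, a, rfl⟩ := v
        exact ⟨a, rfl⟩)
    rw [← e.tsum_eq]
    rfl
  rw [key, key, mixedEmbedding.finrank] at h
  have e1 : ∀ a : 𝓞 K, gss (fun u => qf K (x * u)) 1 (mixedEmbedding K a) = ENNReal.ofReal (Real.exp (-qf K (mixedEmbedding K a * x))) := by
    intro a; simp only [gss, one_mul]; rw [mul_comm x]
  have e2 : ∀ a : 𝓞 K, gss (fun u => qf K (x * u)) (s ^ 2) (mixedEmbedding K a) = ENNReal.ofReal (Real.exp (-qf K (mixedEmbedding K a * (s • x)))) := by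
    intro a
    simp only [gss]
    rw [mul_smul_comm, qf_smul, mul_comm x]
  simp_rw [e1, e2] at h
  exact h

end mix3

end part3

section part4

open MeasureTheory Module
set_option linter.unusedSectionVars false
set_option linter.unusedSimpArgs false
open NumberField NumberField.InfinitePlace NumberField.mixedEmbedding

section mix4
open scoped Classical
variable {K : Type*} [Field K] [NumberField K]

lemma count_cone (x : mixedSpace K) (hx : mixedEmbedding.norm x ≠ 0) :
    ∑' u : (𝓞 K)ˣ, (fundamentalCone K).indicator (1 : mixedSpace K → ENNReal) (u⁻¹ • x) =
      Units.torsionOrder K := by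
  obtain ⟨u₀, hu₀⟩ := fundamentalCone.exists_unit_smul_mem hx
  rw [← (Equiv.inv (𝓞 K)ˣ).tsum_eq, ← (Equiv.mulRight u₀).tsum_eq]
  have : ∀ u : (𝓞 K)ˣ, (fundamentalCone K).indicator (1 : mixedSpace K → ENNReal) ((Equiv.inv (𝓞 K)ˣ (Equiv.mulRight u₀ u))⁻¹ • x)
      = (Units.torsion K : Set (𝓞 K)ˣ).indicator 1 u := by
    intro u
    have h := fundamentalCone.unit_smul_mem_iff_mem_torsion hu₀ u
    rw [Equiv.inv_apply, inv_inv, Equiv.coe_mulRight, mul_smul]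
    by_cases hu : u ∈ Units.torsion K
    · rw [Set.indicator_of_mem (h.mpr hu), Set.indicator_of_mem (by exact hu)]; rfl
    · rw [Set.indicator_of_notMem (fun h' => hu (h.mp h')), Set.indicator_of_notMem (by exact hu)]
  simp_rw [this]
  rw [← tsum_subtype]
  simp [Units.torsionOrder, ENat.card_eq_coe_natCard]

lemma countable_OK : Countable (𝓞 K) := by
  have hc : Countable (mixedEmbedding.integerLattice K) := inferInstance
  refine Function.Injective.countable (β := mixedEmbedding.integerLattice K) (f := fun a => ⟨mixedEmbedding K a, ⟨a, rfl⟩⟩) fun a b hab => ?_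
  exact RingOfIntegers.ext (mixedEmbedding_injective K (congrArg Subtype.val hab))

lemma countable_units : Countable (𝓞 K)ˣ := by
  have := countable_OK (K := K)
  exact Function.Injective.countable Units.val_injective

lemma unfold_cone (f : mixedSpace K → ENNReal) (hf : Measurable f)
    (h0 : ∀ x, mixedEmbedding.norm x = 0 → f x = 0) :
    ∑' u : (𝓞 K)ˣ, ∫⁻ x in fundamentalCone K, f (u • x) = Units.torsionOrder K * ∫⁻ x, f x := by
  have hc := measurableSet_fundamentalCone K
  have h1 : ∀ u : (𝓞 K)ˣ, ∫⁻ x in fundamentalCone K, f (u • x) =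
      ∫⁻ x, (fundamentalCone K).indicator (1 : mixedSpace K → ENNReal) (u⁻¹ • x) * f x := by
    intro u
    rw [← lintegral_indicator hc]
    rw [← (mp_unit u).lintegral_comp (f := fun x => (fundamentalCone K).indicator (1 : mixedSpace K → ENNReal) (u⁻¹ • x) * f x)]
    · refine lintegral_congr fun x => ?_
      rw [inv_smul_smul]
      by_cases hx : x ∈ fundamentalCone K
      · simp [hx]
      · simp [hx]
    · exact ((measurable_one.indicator hc).comp (mp_unit u⁻¹).measurable).mul hf
  simp_rw [h1]
  have hcount : Countable (𝓞 K)ˣ := countable_units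
  rw [← lintegral_tsum (f := fun (u : (𝓞 K)ˣ) x => (fundamentalCone K).indicator (1 : mixedSpace K → ENNReal) (u⁻¹ • x) * f x) (fun u => (((measurable_one.indicator hc).comp (mp_unit u⁻¹).measurable).mul hf).aemeasurable)]
  rw [← lintegral_const_mul _ hf]
  refine lintegral_congr fun x => ?_
  by_cases hx : mixedEmbedding.norm x = 0
  · simp [h0 x hx]
  · rw [ENNReal.tsum_mul_right, count_cone x hx]

lemma scale_cone (f : mixedSpace K → ENNReal) (hf : Measurable f) {s : ℝ} (hs : 0 < s) :
    ENNReal.ofReal (s ^ finrank ℚ K) * ∫⁻ x in fundamentalCone K, f (s • x) =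
      ∫⁻ x in fundamentalCone K, f x := by
  have hc := measurableSet_fundamentalCone K
  have hm := Measure.map_addHaar_smul (volume : Measure (mixedSpace K)) hs.ne'
  rw [mixedEmbedding.finrank] at hm
  have hms : Measurable fun x : mixedSpace K => s • x := measurable_const_smul s
  rw [← lintegral_indicator hc, ← lintegral_indicator hc]
  have : ∫⁻ x, (fundamentalCone K).indicator f x ∂(Measure.map (s • ·) (volume : Measure (mixedSpace K)))
     = ∫⁻ x : mixedSpace K, (fundamentalCone K).indicator (fun x => f (s • x)) x := by
    rw [lintegral_map (hf.indicator hc) hms]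
    refine lintegral_congr fun x => ?_
    by_cases hx : x ∈ fundamentalCone K
    · rw [Set.indicator_of_mem hx, Set.indicator_of_mem ((fundamentalCone.smul_mem_iff_mem hs.ne').mpr hx)]
    · rw [Set.indicator_of_notMem hx, Set.indicator_of_notMem (fun h => hx ((fundamentalCone.smul_mem_iff_mem hs.ne').mp h))]
  rw [← this, hm, lintegral_smul_measure, smul_eq_mul, ← mul_assoc, ← ENNReal.ofReal_mul (by positivity)]
  rw [abs_of_pos (by positivity), mul_inv_cancel₀ (by positivity)]
  simp

/-- nonzero principal ideals -/
abbrev PI (K : Type*) [Field K] [NumberField K] := {I : Ideal (𝓞 K) // Submodule.IsPrincipal I ∧ I ≠ ⊥}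

noncomputable def gen (I : PI K) : 𝓞 K := @Submodule.IsPrincipal.generator _ _ _ _ _ I.1 I.2.1

lemma span_gen (I : PI K) : Ideal.span {gen I} = I.1 := by
  have := I.2.1
  exact Ideal.span_singleton_generator I.1

lemma gen_ne_zero (I : PI K) : gen I ≠ 0 := by
  intro h
  have := span_gen I
  rw [h] at this
  apply I.2.2
  rw [← this]; simp

lemma countable_PI : Countable (PI K) := by
  have := countable_OK (K := K)
  refine Function.Injective.countable (f := gen (K := K)) fun I J h => ?_
  exact Subtype.ext (by rw [← span_gen I, h, span_gen])

lemma tsum_split (f : 𝓞 K → ENNReal) :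
    ∑' a, f a = f 0 + ∑' I : PI K, ∑' u : (𝓞 K)ˣ, f (u * gen I) := by
  rw [← ENNReal.tsum_prod (f := fun (I : PI K) (u : (𝓞 K)ˣ) => f (u * gen I))]
  have hinj : Function.Injective (fun p : PI K × (𝓞 K)ˣ => ((p.2 : 𝓞 K) * gen p.1)) := by
    rintro ⟨I, u⟩ ⟨J, v⟩ h
    simp only at h
    have h1 : Ideal.span {(u : 𝓞 K) * gen I} = Ideal.span {(v : 𝓞 K) * gen J} := by rw [h]
    rw [Ideal.span_singleton_mul_left_unit u.isUnit, Ideal.span_singleton_mul_left_unit v.isUnit, span_gen, span_gen] at h1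
    have h2 : I = J := Subtype.ext h1
    subst h2
    have := mul_right_cancel₀ (gen_ne_zero I) h
    rw [Units.ext this]
  have hr : Set.range (fun p : PI K × (𝓞 K)ˣ => ((p.2 : 𝓞 K) * gen p.1)) = {0}ᶜ := by
    ext a
    simp only [Set.mem_range, Prod.exists, Set.mem_compl_iff, Set.mem_singleton_iff]
    constructor
    · rintro ⟨I, u, rfl⟩
      exact mul_ne_zero u.ne_zero (gen_ne_zero I)
    · intro ha
      let I : PI K := ⟨Ideal.span {a}, ⟨⟨a, rfl⟩⟩, by simpa using ha⟩
      have h : Ideal.span {gen I} = Ideal.span {a} := span_gen I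
      rw [Ideal.span_singleton_eq_span_singleton] at h
      obtain ⟨u, hu⟩ := h
      exact ⟨I, u, by rw [← hu, mul_comm]⟩
  have h1 := tsum_range (g := fun p : PI K × (𝓞 K)ˣ => ((p.2 : 𝓞 K) * gen p.1)) f hinj
  have h2 := (ENNReal.summable (f := fun x : ({0} : Set (𝓞 K)) => f x)).tsum_add_tsum_compl (s := ({0} : Set (𝓞 K))) (f := f) ENNReal.summable
  rw [← h2, ← h1, hr]
  congr 1
  simp [tsum_singleton]

lemma norm_gen (I : PI K) : mixedEmbedding.norm (mixedEmbedding K (gen I)) = Ideal.absNorm I.1 := by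
  rw [mixedEmbedding.norm_eq_norm, ← span_gen I, Ideal.absNorm_span_singleton]
  have := Algebra.coe_norm_int (gen I)
  rw [show Algebra.norm ℚ ((gen I : 𝓞 K) : K) = ((Algebra.norm ℤ (gen I) : ℤ) : ℚ) from this.symm]
  rw [Nat.cast_natAbs, Int.cast_abs]
  simp

end mix4

end part4

section part5

open MeasureTheory Module
set_option linter.unusedSectionVars false
set_option linter.unusedSimpArgs false
open NumberField NumberField.InfinitePlace NumberField.mixedEmbedding

section mix5
open scoped Classical
variable {K : Type*} [Field K] [NumberField K]

noncomputable def gg (x : mixedSpace K) : ENNReal := ENNReal.ofReal (Real.exp (-qf K x))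

lemma measurable_gg : Measurable (gg (K := K)) := by
  have := (continuous_qf (K := K)).measurable
  unfold gg
  fun_prop

lemma measurable_gg_mul (y : mixedSpace K) : Measurable (fun x => gg (K := K) (y * x)) :=
  measurable_gg.comp (continuous_const.mul continuous_id).measurable

noncomputable def Ig (K : Type*) [Field K] [NumberField K] (Φ : ℝ → ENNReal) (y : mixedSpace K) : ENNReal :=
  ∫⁻ x, Φ (mixedEmbedding.norm x) * gg (y * x)

lemma measurable_normE : Measurable (fun x : mixedSpace K => mixedEmbedding.norm x) :=
  (mixedEmbedding.continuous_norm K).measurable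

lemma cone_theta (Φ : ℝ → ENNReal) (hΦ : Measurable Φ) (h0 : Φ 0 = 0) :
    ∫⁻ x in fundamentalCone K, Φ (mixedEmbedding.norm x) * ∑' a : 𝓞 K, gg (mixedEmbedding K a * x) =
    (∫⁻ x in fundamentalCone K, Φ (mixedEmbedding.norm x)) +
      Units.torsionOrder K * ∑' I : PI K, Ig K Φ (mixedEmbedding K (gen I)) := by
  have hc1 := countable_units (K := K)
  have hc2 := countable_PI (K := K)
  have hΦN : Measurable fun x : mixedSpace K => Φ (mixedEmbedding.norm x) := hΦ.comp measurable_normE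
  have hg0 : gg (0 : mixedSpace K) = 1 := by
    have : qf K 0 = 0 := by simp [qf]
    simp [gg, this]
  have hu : ∀ (I : PI K) (u : (𝓞 K)ˣ) (x : mixedSpace K),
      Φ (mixedEmbedding.norm x) * gg (mixedEmbedding K ((u * gen I : 𝓞 K) : K) * x) =
      (fun z => Φ (mixedEmbedding.norm z) * gg (mixedEmbedding K (gen I : K) * z)) (u • x) := by
    intro I u x
    have e : mixedEmbedding K ((u * gen I : 𝓞 K) : K) * x = mixedEmbedding K (gen I : K) * (u • x) := by
      rw [unitSMul_smul, show ((u * gen I : 𝓞 K) : K) = algebraMap (𝓞 K) K u * (gen I : K) from rfl, map_mul, mul_left_comm, ← mul_assoc]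
    simp only [e, norm_unit_smul]
  have h1 : ∀ x : mixedSpace K, Φ (mixedEmbedding.norm x) * ∑' a : 𝓞 K, gg (mixedEmbedding K a * x) =
      Φ (mixedEmbedding.norm x) + ∑' I : PI K, ∑' u : (𝓞 K)ˣ, 
      (fun z => Φ (mixedEmbedding.norm z) * gg (mixedEmbedding K (gen I : K) * z)) (u • x) := by
    intro x
    rw [tsum_split, mul_add]
    congr 1
    · simp [hg0]
    · rw [← ENNReal.tsum_mul_left]
      refine tsum_congr fun I => ?_
      rw [← ENNReal.tsum_mul_left]
      exact tsum_congr fun u => hu I u x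
  have hm : ∀ (I : PI K), Measurable (fun z => Φ (mixedEmbedding.norm z) * gg (mixedEmbedding K (gen I : K) * z)) :=
    fun I => hΦN.mul (measurable_gg_mul _)
  have hm2 : ∀ (I : PI K) (u : (𝓞 K)ˣ), Measurable (fun x : mixedSpace K => (fun z => Φ (mixedEmbedding.norm z) * gg (mixedEmbedding K (gen I : K) * z)) (u • x)) :=
    fun I u => (hm I).comp (mp_unit u).measurable
  simp_rw [h1]
  rw [lintegral_add_left hΦN]
  congr 1
  rw [lintegral_tsum (fun I => (Measurable.tsum (hm2 I)).aemeasurable), ← ENNReal.tsum_mul_left]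
  refine tsum_congr fun I => ?_
  rw [lintegral_tsum (fun u => (hm2 I u).aemeasurable)]
  exact unfold_cone _ (hm I) (fun x hx => by simp [hx, h0])

lemma measurable_theta : Measurable fun x : mixedSpace K => ∑' a : 𝓞 K, gg (mixedEmbedding K a * x) := by
  have := countable_OK (K := K)
  exact Measurable.tsum fun a => measurable_gg_mul _

lemma exists_root (n : ℕ) (hn : 0 < n) : ∃ s : ℝ, 1 < s ∧ s ^ n = 2 := by
  refine ⟨(2:ℝ) ^ ((n:ℝ)⁻¹), Real.one_lt_rpow (by norm_num) (by positivity), ?_⟩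
  exact Real.rpow_inv_natCast_pow (by norm_num) hn.ne'

lemma main_ineq (Φ : ℝ → ENNReal) (hΦ : Measurable Φ) (h0 : Φ 0 = 0) :
    (Units.torsionOrder K * ∑' I : PI K, Ig K Φ (mixedEmbedding K (gen I))) ≤
    (∫⁻ x in fundamentalCone K, Φ (mixedEmbedding.norm x / 2)) +
      Units.torsionOrder K * ∑' I : PI K, Ig K (fun y => Φ (y / 2)) (mixedEmbedding K (gen I)) := by
  obtain ⟨s, hs1, hs2⟩ := exists_root (finrank ℚ K) finrank_pos
  have hs0 : 0 < s := by linarith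
  have hΦ2 : Measurable fun y => Φ (y / 2) := hΦ.comp (measurable_id.div_const 2)
  rw [← cone_theta (fun y => Φ (y / 2)) hΦ2 (by simp [h0])]
  rw [← scale_cone (fun x => Φ (mixedEmbedding.norm x / 2) * ∑' a : 𝓞 K, gg (mixedEmbedding K a * x)) 
    ((hΦ2.comp measurable_normE).mul measurable_theta) hs0]
  refine le_trans (le_add_self.trans (cone_theta (K := K) Φ hΦ h0).ge) ?_
  rw [← lintegral_const_mul']
  swap
  · exact ENNReal.ofReal_ne_top
  refine setLIntegral_mono' (measurableSet_fundamentalCone K) fun x hx => ?_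
  have hn : mixedEmbedding.norm (s • x) / 2 = mixedEmbedding.norm x := by
    rw [mixedEmbedding.norm_smul, abs_of_pos hs0, hs2]; ring
  rw [hn, mul_left_comm]
  gcongr
  exact theta_mixed x (fundamentalCone.norm_pos_of_mem hx).ne' hs1

lemma vol_cone_le (Y : ℝ) (hY : 0 < Y) :
    volume {x : mixedSpace K | x ∈ fundamentalCone K ∧ mixedEmbedding.norm x ≤ Y} =
     ENNReal.ofReal Y * (2 ^ nrRealPlaces K * NNReal.pi ^ nrComplexPlaces K * ENNReal.ofReal (Units.regulator K)) := by
  rw [← fundamentalCone.volume_normLeOne]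
  set s : ℝ := Y ^ ((finrank ℚ K : ℝ)⁻¹)
  have hs0 : 0 < s := by positivity
  have hs : s ^ finrank ℚ K = Y := Real.rpow_inv_natCast_pow hY.le finrank_pos.ne'
  have h := Measure.addHaar_smul (volume : Measure (mixedSpace K)) s (fundamentalCone.normLeOne K)
  rw [mixedEmbedding.finrank, hs, abs_of_pos hY] at h
  rw [← h]
  congr 1
  ext x
  rw [Set.mem_smul_set_iff_inv_smul_mem₀ hs0.ne', fundamentalCone.mem_normLeOne, fundamentalCone.smul_mem_iff_mem (by positivity),
    mixedEmbedding.norm_smul, abs_of_pos (by positivity), inv_pow, hs, inv_mul_le_one₀ hY]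
  rfl

end mix5

end part5

section part6

open MeasureTheory Module
set_option linter.unusedSectionVars false
set_option linter.unusedSimpArgs false
open NumberField NumberField.InfinitePlace NumberField.mixedEmbedding

section mix6
open scoped Classical
variable (K : Type*) [Field K] [NumberField K]

open Filter Ideal Asymptotics in
lemma summable_zeta {σ : ℝ} (hσ : 1 < σ) :
    Summable fun n : ℕ => (Nat.card {I : Ideal (𝓞 K) // absNorm I = n} : ℝ) * (if n = 0 then 0 else (n : ℝ) ^ (-σ)) := by
  have ht : Tendsto (fun n : ℕ => (∑ k ∈ Finset.Icc 1 n, (Nat.card {I : Ideal (𝓞 K) // absNorm I = k} : ℝ)) / (n : ℝ)) atTop (nhds (dedekindZeta_residue K)) := by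
    refine ((Ideal.tendsto_norm_le_div_atTop₀ K).comp tendsto_natCast_atTop_atTop).congr fun n ↦ ?_
    simp only [Function.comp_apply, Nat.cast_le, ← Nat.cast_sum]
    congr
    rw [← add_left_inj 1, ← card_norm_le_eq_card_norm_le_add_one,
      show Finset.Icc 1 n = Finset.Ioc 0 n from Finset.Icc_succ_left_eq_Ioc _ _,
      show 1 = Nat.card {I : Ideal (𝓞 K) // absNorm I = 0} by simp [Ideal.absNorm_eq_zero_iff],
      Finset.sum_Ioc_add_eq_sum_Icc (n.zero_le),
      ← Finset.card_preimage_eq_sum_card_image_eq (fun k _ ↦ finite_setOfPred_absNorm_eq k)]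
    simp [Set.coe_eq_subtype]
  have hO : (fun n : ℕ => ∑ k ∈ Finset.Icc 1 n, (Nat.card {I : Ideal (𝓞 K) // absNorm I = k} : ℝ)) =O[atTop] fun n => (n : ℝ) ^ (1 : ℝ) := by
    simp only [Real.rpow_one]
    exact isBigO_of_div_tendsto_nhds (by
      filter_upwards [eventually_ge_atTop 1] with n hn h0
      have : (n : ℝ) ≠ 0 := by positivity
      exact absurd h0 this) _ ht
  have h := LSeriesSummable_of_sum_norm_bigO_and_nonneg (s := (σ : ℂ)) hO (fun n => Nat.cast_nonneg _) zero_le_one (by simpa using hσ)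
  have h2 := h.norm
  refine h2.congr fun n => ?_
  rw [LSeries.norm_term_eq]
  split_ifs with hn
  · simp
  · have : 0 < (n:ℝ) := by positivity
    simp [Real.rpow_neg this.le, div_eq_mul_inv]

lemma tsum_PI_ne_top {σ : ℝ} (hσ : 1 < σ) :
    ∑' I : PI K, ENNReal.ofReal ((Ideal.absNorm I.1 : ℝ) ^ (-σ)) ≠ ⊤ := by
  have hs := (summable_zeta K hσ).tsum_ofReal_ne_top
  refine ne_top_of_le_ne_top hs ?_
  rw [← (Equiv.sigmaFiberEquiv (fun I : PI K => Ideal.absNorm I.1)).tsum_eq, ENNReal.tsum_sigma']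
  refine ENNReal.tsum_le_tsum fun n => ?_
  have hfin : Finite {I : Ideal (𝓞 K) // Ideal.absNorm I = n} := Ideal.finite_setOfPred_absNorm_eq n
  let φ : {I : PI K // Ideal.absNorm I.1 = n} → {I : Ideal (𝓞 K) // Ideal.absNorm I = n} := fun I => ⟨I.1.1, I.2⟩
  have hφ : Function.Injective φ := fun I J h => Subtype.ext (Subtype.ext (congrArg (fun x => x.1) h))
  have hfin2 : Finite {I : PI K // Ideal.absNorm I.1 = n} := Finite.of_injective φ hφ
  have hle := Nat.card_le_card_of_injective φ hφ
  have he : ∀ I : {I : PI K // Ideal.absNorm I.1 = n}, ENNReal.ofReal ((Ideal.absNorm ((Equiv.sigmaFiberEquiv (fun I : PI K => Ideal.absNorm I.1)) ⟨n, I⟩).1 : ℝ) ^ (-σ)) = ENNReal.ofReal (if n = 0 then 0 else (n : ℝ) ^ (-σ)) := by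
    intro I
    have hI : Ideal.absNorm ((Equiv.sigmaFiberEquiv (fun I : PI K => Ideal.absNorm I.1)) ⟨n, I⟩).1 = n := I.2
    have hn : n ≠ 0 := by
      intro h
      exact I.1.2.2 (Ideal.absNorm_eq_zero_iff.mp (I.2.trans h))
    rw [hI, if_neg hn]
  simp_rw [he]
  rw [ENNReal.tsum_const, ENat.card_eq_coe_natCard, ENNReal.ofReal_mul (by positivity), ENNReal.ofReal_natCast]
  gcongr
  simpa using hle

end mix6

end part6

section part7

open MeasureTheory Module
set_option linter.unusedSectionVars false
set_option linter.unusedSimpArgs false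
open NumberField NumberField.InfinitePlace NumberField.mixedEmbedding

section mix7
open scoped Classical

noncomputable def fY (s t Y y : ℝ) : ℝ := y ^ (s - 1) - Y ^ (-(t - s)) * y ^ (t - 1)

lemma fY_eq {s t Y y : ℝ} (hst : s < t) (hY : 0 < Y) (hy : 0 < y) :
    fY s t Y y = y ^ (s - 1) * (1 - (y / Y) ^ (t - s)) := by
  rw [fY, Real.div_rpow hy.le hY.le, Real.rpow_neg hY.le, show t - 1 = (s - 1) + (t - s) by ring, Real.rpow_add hy]
  ring

lemma pw_real {s t Y y : ℝ} (hs : 1 < s) (hst : s < t) (hY : 0 < Y) (hy : 0 ≤ y) :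
    max (fY s t Y (y / 2)) 0 + (1 - 2 ^ (-(s - 1))) * y ^ (s - 1) ≤
    max (fY s t Y y) 0 + Y ^ (-(t - s)) * y ^ (t - 1) := by
  have e1 : (y / 2) ^ (s - 1) = 2 ^ (-(s - 1)) * y ^ (s - 1) := by
    rw [Real.div_rpow hy (by norm_num), Real.rpow_neg (by norm_num)]; ring
  have hA : 0 ≤ Y ^ (-(t - s)) * (y / 2) ^ (t - 1) := by positivity
  by_cases h : y / 2 ≤ Y
  · have h0 : 0 ≤ fY s t Y (y / 2) := by
      rcases hy.eq_or_lt with rfl | hy'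
      · simp [fY, Real.zero_rpow (show s - 1 ≠ 0 by linarith), Real.zero_rpow (show t - 1 ≠ 0 by linarith)]
      · rw [fY_eq hst hY (by positivity)]
        have : (y / 2 / Y) ^ (t - s) ≤ 1 := Real.rpow_le_one (by positivity) (by rw [div_le_one hY]; exact h) (by linarith)
        have h2 : 0 ≤ (y / 2) ^ (s - 1) := by positivity
        exact mul_nonneg h2 (by linarith)
    rw [max_eq_left h0]
    have := le_max_left (fY s t Y y) 0
    simp only [fY] at this ⊢
    rw [e1]
    linarith
  · push Not at h
    have hy' : 0 < y := by linarith
    have h1 : fY s t Y (y / 2) ≤ 0 := by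
      rw [fY_eq hst hY (by positivity)]
      have : 1 ≤ (y / 2 / Y) ^ (t - s) := Real.one_le_rpow (by rw [le_div_iff₀ hY]; linarith) (by linarith)
      have h2 : 0 ≤ (y / 2) ^ (s - 1) := by positivity
      exact mul_nonpos_of_nonneg_of_nonpos h2 (by linarith)
    have h2 : fY s t Y y ≤ 0 := by
      rw [fY_eq hst hY (by positivity)]
      have : 1 ≤ (y / Y) ^ (t - s) := Real.one_le_rpow (by rw [le_div_iff₀ hY]; linarith) (by linarith)
      have h2 : 0 ≤ y ^ (s - 1) := by positivity
      exact mul_nonpos_of_nonneg_of_nonpos h2 (by linarith)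
    rw [max_eq_right h1]
    have := le_max_right (fY s t Y y) 0
    have h3 : (0:ℝ) ≤ 2 ^ (-(s - 1)) * y ^ (s - 1) := by positivity
    simp only [fY] at this h2 ⊢
    linarith

lemma pw {s t Y y : ℝ} (hs : 1 < s) (hst : s < t) (hY : 0 < Y) (hy : 0 ≤ y) :
    ENNReal.ofReal (fY s t Y (y / 2)) + ENNReal.ofReal ((1 - 2 ^ (-(s - 1))) * y ^ (s - 1)) ≤
    ENNReal.ofReal (fY s t Y y) + ENNReal.ofReal (Y ^ (-(t - s)) * y ^ (t - 1)) := by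
  have k : (0:ℝ) ≤ 1 - 2 ^ (-(s - 1)) := by
    have : (2:ℝ) ^ (-(s - 1)) ≤ 1 := Real.rpow_le_one_of_one_le_of_nonpos (by norm_num) (by linarith)
    linarith
  have e : ∀ z : ℝ, ENNReal.ofReal z = ENNReal.ofReal (max z 0) := by
    intro z; rw [ENNReal.ofReal_max]; simp
  rw [e (fY s t Y (y / 2)), e (fY s t Y y), ← ENNReal.ofReal_add (by positivity) (by positivity), ← ENNReal.ofReal_add (by positivity) (by positivity)]
  exact ENNReal.ofReal_le_ofReal (pw_real hs hst hY hy)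

lemma measurable_fY (s t Y : ℝ) : Measurable (fY s t Y) := by
  unfold fY; fun_prop

lemma fY_le {s t Y y : ℝ} (hY : 0 < Y) (hy : 0 ≤ y) :
    fY s t Y y ≤ y ^ (s - 1) := by
  have : 0 ≤ Y ^ (-(t - s)) * y ^ (t - 1) := by positivity
  unfold fY; linarith

lemma fY_nonpos {s t Y y : ℝ} (hst : s < t) (hY : 0 < Y) (hy : Y ≤ y) : fY s t Y y ≤ 0 := by
  have hy0 : 0 < y := by linarith
  rw [fY_eq hst hY (by positivity)]
  have : 1 ≤ (y / Y) ^ (t - s) := Real.one_le_rpow (by rw [le_div_iff₀ hY]; linarith) (by linarith)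
  have h2 : 0 ≤ y ^ (s - 1) := by positivity
  exact mul_nonpos_of_nonneg_of_nonpos h2 (by linarith)

variable {K : Type*} [Field K] [NumberField K]

lemma Ig_pow (y : mixedSpace K) (hy : mixedEmbedding.norm y ≠ 0) {s : ℝ} (hs : 0 < s) {c : ℝ} (hc : 0 ≤ c) :
    Ig K (fun r => ENNReal.ofReal (c * r ^ (s - 1))) y = ENNReal.ofReal (c * (mixedEmbedding.norm y ^ (-s) * Mt K s)) := by
  rw [ENNReal.ofReal_mul hc, ← lintegral_gauss y hy hs, ← lintegral_const_mul' _ _ ENNReal.ofReal_ne_top]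
  unfold Ig gg
  refine lintegral_congr fun x => ?_
  have := mixedEmbedding.norm_nonneg x
  rw [← ENNReal.ofReal_mul (by positivity), ← ENNReal.ofReal_mul hc, mul_assoc]

lemma Ig_add (Φ Ψ : ℝ → ENNReal) (hΦ : Measurable Φ) (y : mixedSpace K) :
    Ig K (fun r => Φ r + Ψ r) y = Ig K Φ y + Ig K Ψ y := by
  unfold Ig
  rw [← lintegral_add_left (f := fun x => Φ (mixedEmbedding.norm x) * gg (y * x)) ((hΦ.comp measurable_normE).mul (measurable_gg_mul y))]
  refine lintegral_congr fun x => ?_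
  simp only [add_mul]

lemma Ig_mono (Φ Ψ : ℝ → ENNReal) (h : ∀ r, 0 ≤ r → Φ r ≤ Ψ r) (y : mixedSpace K) :
    Ig K Φ y ≤ Ig K Ψ y := by
  refine lintegral_mono fun x => ?_
  dsimp only
  gcongr
  exact h _ (mixedEmbedding.norm_nonneg x)

lemma Ig_step (a : mixedSpace K) (ha : 1 ≤ mixedEmbedding.norm a) {s t Y : ℝ} (hs : 1 < s) (hst : s < t) (hY : 0 < Y)
    (h : Y ^ (-(t - s)) * Mt K t ≤ (1 - 2 ^ (-(s - 1))) / 2 * Mt K s) :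
    Ig K (fun y => ENNReal.ofReal (fY s t Y (y / 2))) a +
      ENNReal.ofReal ((1 - 2 ^ (-(s - 1))) / 2 * Mt K s * mixedEmbedding.norm a ^ (-s)) ≤
    Ig K (fun y => ENNReal.ofReal (fY s t Y y)) a := by
  set k : ℝ := 1 - 2 ^ (-(s - 1)) with hk_def
  have k : 0 ≤ k := by
    have : (2:ℝ) ^ (-(s - 1)) ≤ 1 := Real.rpow_le_one_of_one_le_of_nonpos (by norm_num) (by linarith)
    linarith
  have hm := measurable_fY s t Y
  have h1 := Ig_mono (K := K) _ _ (fun r hr => pw hs hst hY hr) a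
  rw [Ig_add _ _ (by fun_prop), Ig_add _ _ (by fun_prop), Ig_pow a (by positivity) (by linarith) k,
    Ig_pow a (by positivity) (by linarith) (by positivity)] at h1
  have hMs := Mt_pos (K := K) (show 0 < s by linarith)
  have hMt := Mt_pos (K := K) (show 0 < t by linarith)
  have h2 : Y ^ (-(t - s)) * (mixedEmbedding.norm a ^ (-t) * Mt K t) ≤ (1 - 2 ^ (-(s - 1))) / 2 * Mt K s * mixedEmbedding.norm a ^ (-s) := by
    have h3 : mixedEmbedding.norm a ^ (-t) ≤ mixedEmbedding.norm a ^ (-s) := Real.rpow_le_rpow_of_exponent_le ha (by linarith)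
    calc _ = (Y ^ (-(t - s)) * Mt K t) * mixedEmbedding.norm a ^ (-t) := by ring
      _ ≤ _ := by gcongr
  have h4 := h1.trans (add_le_add le_rfl (ENNReal.ofReal_le_ofReal h2))
  have e : (1 - 2 ^ (-(s - 1))) * (mixedEmbedding.norm a ^ (-s) * Mt K s) = 
    (1 - 2 ^ (-(s - 1))) / 2 * Mt K s * mixedEmbedding.norm a ^ (-s) + (1 - 2 ^ (-(s - 1))) / 2 * Mt K s * mixedEmbedding.norm a ^ (-s) := by ring
  have h5 : 0 ≤ (1 - 2 ^ (-(s - 1))) / 2 * Mt K s * mixedEmbedding.norm a ^ (-s) := by positivity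
  rw [hk_def, e, ENNReal.ofReal_add h5 h5, ← add_assoc] at h4
  exact (ENNReal.add_le_add_iff_right ENNReal.ofReal_ne_top).mp h4

lemma one_le_norm_gen (I : PI K) : 1 ≤ mixedEmbedding.norm (mixedEmbedding K (gen I)) := by
  rw [norm_gen]
  have : Ideal.absNorm I.1 ≠ 0 := fun h => I.2.2 (Ideal.absNorm_eq_zero_iff.mp h)
  exact_mod_cast Nat.one_le_iff_ne_zero.mpr this

lemma cone_int_le {s t Y : ℝ} (hs : 1 < s) (hst : s < t) (hY : 0 < Y) :
    ∫⁻ x in fundamentalCone K, ENNReal.ofReal (fY s t Y (mixedEmbedding.norm x / 2)) ≤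
     ENNReal.ofReal (2 * Y ^ s * (2 ^ nrRealPlaces K * Real.pi ^ nrComplexPlaces K * Units.regulator K)) := by
  have hc := measurableSet_fundamentalCone K
  have hS : MeasurableSet {x : mixedSpace K | x ∈ fundamentalCone K ∧ mixedEmbedding.norm x ≤ 2 * Y} :=
    hc.inter (measurableSet_le measurable_normE measurable_const)
  calc _ ≤ ∫⁻ x in {x : mixedSpace K | x ∈ fundamentalCone K ∧ mixedEmbedding.norm x ≤ 2 * Y}, ENNReal.ofReal (Y ^ (s - 1)) := by
        rw [← lintegral_indicator hc, ← lintegral_indicator hS]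
        refine lintegral_mono fun x => ?_
        by_cases h1 : x ∈ fundamentalCone K
        · by_cases h2 : mixedEmbedding.norm x ≤ 2 * Y
          · rw [Set.indicator_of_mem h1, Set.indicator_of_mem (show x ∈ {x : mixedSpace K | x ∈ fundamentalCone K ∧ mixedEmbedding.norm x ≤ 2 * Y} from ⟨h1, h2⟩)]
            have h0 := mixedEmbedding.norm_nonneg x
            refine ENNReal.ofReal_le_ofReal ((fY_le hY (by positivity)).trans ?_)
            exact Real.rpow_le_rpow (by positivity) (by linarith) (by linarith)
          · rw [Set.indicator_of_mem h1, ENNReal.ofReal_of_nonpos (fY_nonpos hst hY (by linarith))]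
            exact zero_le
        · rw [Set.indicator_of_notMem h1]
          exact zero_le
    _ = _ := by
        rw [setLIntegral_const, vol_cone_le _ (by positivity)]
        have hR := Units.regulator_pos K
        rw [show 2 * Y ^ s * (2 ^ nrRealPlaces K * Real.pi ^ nrComplexPlaces K * Units.regulator K) =
           Y ^ (s - 1) * (2 * Y * (2 ^ nrRealPlaces K * Real.pi ^ nrComplexPlaces K * Units.regulator K)) by
             rw [Real.rpow_sub_one hY.ne']; field_simp]
        have hp := Real.pi_pos
        have e : ENNReal.ofReal (2 ^ nrRealPlaces K * Real.pi ^ nrComplexPlaces K * Units.regulator K) =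
            2 ^ nrRealPlaces K * NNReal.pi ^ nrComplexPlaces K * ENNReal.ofReal (Units.regulator K) := by
          rw [ENNReal.ofReal_mul (by positivity), ENNReal.ofReal_mul (by positivity), ENNReal.ofReal_pow (by norm_num), ENNReal.ofReal_pow hp.le,
            ← NNReal.coe_real_pi, ENNReal.ofReal_coe_nnreal, ENNReal.ofReal_ofNat]
        rw [← e, ← ENNReal.ofReal_mul (by positivity), ← ENNReal.ofReal_mul (by positivity)]

theorem reg_lower {s t Y : ℝ} (hs : 1 < s) (hst : s < t) (hY : 0 < Y)
    (h : Y ^ (-(t - s)) * Mt K t ≤ (1 - 2 ^ (-(s - 1))) / 2 * Mt K s) :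
    (1 - 2 ^ (-(s - 1))) / 2 * Mt K s ≤ 2 * Y ^ s * (2 ^ nrRealPlaces K * Real.pi ^ nrComplexPlaces K * Units.regulator K) := by
  have hMs := Mt_pos (K := K) (show 0 < s by linarith)
  have hk : (0:ℝ) ≤ 1 - 2 ^ (-(s - 1)) := by
    have : (2:ℝ) ^ (-(s - 1)) ≤ 1 := Real.rpow_le_one_of_one_le_of_nonpos (by norm_num) (by linarith)
    linarith
  have hm := measurable_fY s t Y
  have hmain := main_ineq (K := K) (fun y => ENNReal.ofReal (fY s t Y y)) (by fun_prop) (by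
    simp [fY, Real.zero_rpow (show s - 1 ≠ 0 by linarith), Real.zero_rpow (show t - 1 ≠ 0 by linarith)])
  set D : ENNReal := ENNReal.ofReal ((1 - 2 ^ (-(s - 1))) / 2 * Mt K s) with hD
  set S : ENNReal := ∑' I : PI K, Ig K (fun y => ENNReal.ofReal (fY s t Y (y / 2))) (mixedEmbedding K (gen I)) with hS
  have hSfin : S ≠ ⊤ := by
    have h1 : ∀ I : PI K, Ig K (fun y => ENNReal.ofReal (fY s t Y (y / 2))) (mixedEmbedding K (gen I)) ≤
        ENNReal.ofReal (Mt K s) * ENNReal.ofReal ((Ideal.absNorm I.1 : ℝ) ^ (-s)) := by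
      intro I
      have hg := one_le_norm_gen I
      have h2 := Ig_pow (K := K) (mixedEmbedding K (gen I)) (by positivity) (show 0 < s by linarith) zero_le_one
      rw [norm_gen, one_mul, mul_comm, ENNReal.ofReal_mul hMs.le] at h2
      rw [← h2]
      refine Ig_mono _ _ (fun r hr => ENNReal.ofReal_le_ofReal ((fY_le hY (by positivity)).trans ?_)) _
      rw [one_mul]
      exact Real.rpow_le_rpow (by positivity) (by linarith) (by linarith)
    refine ne_top_of_le_ne_top ?_ (ENNReal.tsum_le_tsum h1)
    rw [ENNReal.tsum_mul_left]
    exact ENNReal.mul_ne_top ENNReal.ofReal_ne_top (tsum_PI_ne_top K hs)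
  have hsum : S + D ≤ ∑' I : PI K, Ig K (fun y => ENNReal.ofReal (fY s t Y y)) (mixedEmbedding K (gen I)) := by
    refine le_trans ?_ (ENNReal.tsum_le_tsum fun I => Ig_step (mixedEmbedding K (gen I)) (one_le_norm_gen I) hs hst hY h)
    rw [ENNReal.tsum_add]
    gcongr
    let I : PI K := ⟨⊤, ⟨⟨1, by simp⟩⟩, top_ne_bot⟩
    refine le_trans ?_ (ENNReal.le_tsum I)
    rw [norm_gen]
    simp [I, hD]
  have hw : (1 : ENNReal) ≤ Units.torsionOrder K := by exact_mod_cast Units.torsionOrder_pos K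
  have h6 : D + Units.torsionOrder K * S ≤ ENNReal.ofReal (2 * Y ^ s * (2 ^ nrRealPlaces K * Real.pi ^ nrComplexPlaces K * Units.regulator K)) + Units.torsionOrder K * S := by
    calc D + Units.torsionOrder K * S ≤ Units.torsionOrder K * (S + D) := by
          rw [mul_add, add_comm]
          gcongr
          exact le_mul_of_one_le_left' hw
      _ ≤ _ := (mul_le_mul_right hsum _).trans (hmain.trans (add_le_add (cone_int_le hs hst hY) le_rfl))
  have h7 := (ENNReal.add_le_add_iff_right (ENNReal.mul_ne_top (by simp) hSfin)).mp h6
  have hR := Units.regulator_pos K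
  have hp := Real.pi_pos
  exact (ENNReal.ofReal_le_ofReal_iff (by positivity)).mp h7

end mix7

end part7

section part8

open MeasureTheory Module
set_option linter.unusedSectionVars false
set_option linter.unusedSimpArgs false
open NumberField NumberField.InfinitePlace NumberField.mixedEmbedding

section mix8
open scoped Classical

noncomputable def rhoR (s : ℝ) : ℝ := Real.Gamma (s / 2) * ((Real.Gamma (s / 2) / Real.Gamma (3 / 4)) ^ (s / (3 / 2 - s))) / 2
noncomputable def rhoC (s : ℝ) : ℝ := Real.Gamma s * ((Real.Gamma s / Real.Gamma (3 / 2)) ^ (s / (3 / 2 - s)))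

lemma gamma34 : Real.Gamma (3 / 4) ^ 2 ≤ Real.sqrt Real.pi := by
  have h := Real.Gamma_mul_add_mul_le_rpow_Gamma_mul_rpow_Gamma (s := 1/2) (t := 1) (a := 1/2) (b := 1/2) (by norm_num) (by norm_num) (by norm_num) (by norm_num) (by norm_num)
  rw [Real.Gamma_one, Real.one_rpow, Real.Gamma_one_half_eq, mul_one, mul_one, show (1/2 * (1/2) + 1/2 : ℝ) = 3/4 by norm_num] at h
  have h0 := Real.Gamma_pos_of_pos (show (0:ℝ) < 3/4 by norm_num)
  calc Real.Gamma (3 / 4) ^ 2 ≤ (Real.sqrt Real.pi ^ (1/2:ℝ)) ^ 2 := by gcongr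
    _ = _ := by rw [← Real.sqrt_eq_rpow, Real.sq_sqrt (Real.sqrt_nonneg _)]

lemma rhoR_one : 1 < rhoR 1 := by
  unfold rhoR
  rw [Real.Gamma_one_half_eq, show (1 / (3 / 2 - 1) : ℝ) = 2 by norm_num, Real.rpow_two, div_pow]
  have hp := Real.pi_gt_three
  have h0 := Real.Gamma_pos_of_pos (show (0:ℝ) < 3/4 by norm_num)
  have h1 : 0 < Real.sqrt Real.pi := Real.sqrt_pos.mpr (by linarith)
  have h2 := Real.sq_sqrt (show 0 ≤ Real.pi by linarith)
  have h3 := gamma34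
  rw [lt_div_iff₀ (by norm_num), mul_div_assoc', lt_div_iff₀ (by positivity), h2]
  nlinarith

lemma rhoC_one : 1 < rhoC 1 := by
  unfold rhoC
  have h : Real.Gamma (3/2) = Real.sqrt Real.pi / 2 := by
    rw [show (3/2:ℝ) = 1/2 + 1 by norm_num, Real.Gamma_add_one (by norm_num), Real.Gamma_one_half_eq]; ring
  rw [Real.Gamma_one, h, show (1 / (3 / 2 - 1) : ℝ) = 2 by norm_num, Real.rpow_two, div_pow, div_pow, Real.sq_sqrt Real.pi_pos.le]
  have := Real.pi_lt_four
  have hp := Real.pi_pos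
  rw [one_mul, lt_div_iff₀ (by positivity)]
  linarith

lemma cont_Gamma {s : ℝ} (hs : 0 < s) : ContinuousAt Real.Gamma s := by
  refine (Real.differentiableAt_Gamma fun m => ?_).continuousAt
  have : (0:ℝ) ≤ m := Nat.cast_nonneg m
  linarith

lemma cont_rhoR : ContinuousAt rhoR 1 := by
  unfold rhoR
  have h1 : ContinuousAt (fun s : ℝ => Real.Gamma (s / 2)) 1 :=
    ContinuousAt.comp (f := fun s : ℝ => s / 2) (cont_Gamma (by norm_num)) (by fun_prop)
  have h0 := Real.Gamma_pos_of_pos (show (0:ℝ) < 3/4 by norm_num)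
  have h2 := Real.Gamma_pos_of_pos (show (0:ℝ) < 1/2 by norm_num)
  refine (h1.mul ((h1.div_const _).rpow ?_ (Or.inl (by positivity)))).div_const 2
  exact continuousAt_id.div (by fun_prop) (by norm_num)

lemma cont_rhoC : ContinuousAt rhoC 1 := by
  unfold rhoC
  have h1 : ContinuousAt (fun s : ℝ => Real.Gamma s) 1 := cont_Gamma (by norm_num)
  have h0 := Real.Gamma_pos_of_pos (show (0:ℝ) < 3/2 by norm_num)
  refine (h1.mul ((h1.div_const _).rpow ?_ (Or.inl (by simp [Real.Gamma_one]; positivity))))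
  exact continuousAt_id.div (by fun_prop) (by norm_num)

lemma exists_s : ∃ s : ℝ, 1 < s ∧ s < 3 / 2 ∧ 1 < rhoR s ∧ 1 < rhoC s := by
  have h1 := cont_rhoR.eventually (lt_mem_nhds rhoR_one)
  have h2 := cont_rhoC.eventually (lt_mem_nhds rhoC_one)
  have h3 : ∀ᶠ s : ℝ in nhds 1, s < 3/2 := gt_mem_nhds (by norm_num)
  have h4 : ∀ᶠ s : ℝ in nhdsWithin 1 (Set.Ioi 1), s < 3/2 ∧ 1 < rhoR s ∧ 1 < rhoC s :=
    ((h3.and (h1.and h2)).filter_mono nhdsWithin_le_nhds)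
  obtain ⟨s, h5, h6⟩ := (h4.and self_mem_nhdsWithin).exists
  exact ⟨s, h6, h5⟩

lemma Mt_ratio (K : Type*) [Field K] [NumberField K] {s : ℝ} (hs : 1 < s) (hs2 : s < 3/2) :
    Mt K s * (Mt K s / Mt K (3/2)) ^ (s / (3 / 2 - s)) =
    rhoR s ^ nrRealPlaces K * rhoC s ^ nrComplexPlaces K * (2 ^ nrRealPlaces K * Real.pi ^ nrComplexPlaces K) := by
  set e := s / (3 / 2 - s) with he
  have h0 := Real.Gamma_pos_of_pos (show (0:ℝ) < 3/2 by norm_num)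
  have h1 := Real.Gamma_pos_of_pos (show (0:ℝ) < 3/4 by norm_num)
  have h2 := Real.Gamma_pos_of_pos (show (0:ℝ) < s by linarith)
  have h3 := Real.Gamma_pos_of_pos (show (0:ℝ) < s / 2 by linarith)
  have hp := Real.pi_pos
  have e1 : Mt K s / Mt K (3/2) = (Real.Gamma (s / 2) / Real.Gamma (3 / 4)) ^ nrRealPlaces K * (Real.Gamma s / Real.Gamma (3 / 2)) ^ nrComplexPlaces K := by
    unfold Mt
    rw [show (3/2/2 : ℝ) = 3/4 by norm_num, mul_pow, mul_pow, div_pow, div_pow]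
    field_simp
  rw [e1, Real.mul_rpow (by positivity) (by positivity), ← Real.rpow_natCast (_ / _), ← Real.rpow_natCast (_ / _),
    ← Real.rpow_mul (by positivity), ← Real.rpow_mul (by positivity), mul_comm (_ : ℝ) e, mul_comm (_ : ℝ) e, Real.rpow_mul (by positivity), Real.rpow_mul (by positivity),
    Real.rpow_natCast, Real.rpow_natCast, rhoR, rhoC, Mt, ← he, div_pow, mul_pow, mul_pow, mul_pow]
  field_simp

lemma Y_lemma {a b k d : ℝ} (s : ℝ) (ha : 0 < a) (hb : 0 < b) (hk : 0 < k) (hd : 0 < d) :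
    ((b / (k * a)) ^ (1 / d)) ^ (-d) = k * a / b ∧
    ((b / (k * a)) ^ (1 / d)) ^ s = (k ^ (s / d))⁻¹ * ((a / b) ^ (s / d))⁻¹ := by
  constructor
  · rw [← Real.rpow_mul (by positivity), show (1 / d * (-d)) = -1 by field_simp, Real.rpow_neg_one, inv_div]
  · rw [← Real.rpow_mul (by positivity), show 1 / d * s = s / d by ring,
      ← mul_inv, ← Real.mul_rpow (by positivity) (by positivity), ← Real.inv_rpow (by positivity)]
    congr 1
    field_simp

theorem reg_exp : ∃ ρ c : ℝ, 1 < ρ ∧ 0 < c ∧ ∀ (K : Type) [Field K] [NumberField K],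
    c * ρ ^ (nrRealPlaces K + nrComplexPlaces K) ≤ Units.regulator K := by
  obtain ⟨s, hs, hs2, hR, hC⟩ := exists_s
  set k : ℝ := (1 - 2 ^ (-(s - 1))) / 2 with hk
  have hk0 : 0 < k := by
    have : (2:ℝ) ^ (-(s - 1)) < 1 := Real.rpow_lt_one_of_one_lt_of_neg (by norm_num) (by linarith)
    linarith
  set e := s / (3 / 2 - s) with he
  have hts : 0 < 3 / 2 - s := by linarith
  refine ⟨min (rhoR s) (rhoC s), k * k ^ e / 2, lt_min hR hC, by positivity, ?_⟩
  intro K _ _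
  have hM1 := Mt_pos (K := K) (show 0 < s by linarith)
  have hM2 := Mt_pos (K := K) (show (0:ℝ) < 3/2 by linarith)
  set Y := (Mt K (3/2) / (k * Mt K s)) ^ (1 / (3/2 - s)) with hY
  have hY0 : 0 < Y := by positivity
  obtain ⟨h1, h2⟩ := Y_lemma s hM1 hM2 hk0 hts
  rw [← hY] at h1 h2
  rw [← he] at h2
  have h3 := reg_lower (K := K) hs hs2 hY0 (by rw [h1, div_mul_cancel₀ _ hM2.ne'])
  rw [h2] at h3
  have h4 := Mt_ratio K hs hs2
  rw [← he] at h4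
  have hp := Real.pi_pos
  have hreg := Units.regulator_pos K
  set Z := (Mt K s / Mt K (3/2)) ^ e with hZ
  have hZ0 : 0 < Z := by positivity
  have hke : 0 < k ^ e := by positivity
  set P : ℝ := 2 ^ nrRealPlaces K * Real.pi ^ nrComplexPlaces K with hP
  have hP0 : 0 < P := by positivity
  have h5 : k * k ^ e / 2 * (Mt K s * Z) ≤ P * Units.regulator K := by
    have : k * Mt K s ≤ 2 * ((k ^ e)⁻¹ * Z⁻¹) * (P * Units.regulator K) := h3
    calc k * k ^ e / 2 * (Mt K s * Z) = (k * Mt K s) * (k ^ e * Z / 2) := by ring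
      _ ≤ 2 * ((k ^ e)⁻¹ * Z⁻¹) * (P * Units.regulator K) * (k ^ e * Z / 2) := by gcongr
      _ = _ := by field_simp
  rw [h4] at h5
  have h6 : k * k ^ e / 2 * (rhoR s ^ nrRealPlaces K * rhoC s ^ nrComplexPlaces K) ≤ Units.regulator K := by
    refine le_of_mul_le_mul_right ?_ hP0
    calc _ = k * k ^ e / 2 * (rhoR s ^ nrRealPlaces K * rhoC s ^ nrComplexPlaces K * P) := by ring
      _ ≤ _ := h5
      _ = _ := by ring
  refine le_trans ?_ h6
  rw [pow_add]
  have hm : 0 ≤ min (rhoR s) (rhoC s) := le_min (by linarith) (by linarith)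
  have hm1 : 0 ≤ rhoR s := by linarith
  gcongr
  · exact min_le_left _ _
  · exact min_le_right _ _

theorem degree_bound (B : ℝ) : ∃ n : ℕ, ∀ (K : Type) [Field K] [NumberField K],
    Units.regulator K ≤ B → finrank ℚ K ≤ n := by
  obtain ⟨ρ, c, hρ, hc, h⟩ := reg_exp
  obtain ⟨m, hm⟩ := pow_unbounded_of_one_lt (B / c) hρ
  refine ⟨2 * m, fun K _ _ hB => ?_⟩
  have h1 := (h K).trans hB
  have h2 : nrRealPlaces K + nrComplexPlaces K < m := by
    by_contra hcon
    push Not at hcon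
    have h3 : ρ ^ m ≤ ρ ^ (nrRealPlaces K + nrComplexPlaces K) := pow_le_pow_right₀ hρ.le hcon
    rw [div_lt_iff₀ hc] at hm
    nlinarith
  have h3 := card_add_two_mul_card_eq_rank K
  omega

end mix8

end part8

section part9

open MeasureTheory Module
set_option linter.unusedSectionVars false
set_option linter.unusedSimpArgs false
open NumberField NumberField.InfinitePlace NumberField.mixedEmbedding
section mix9
open scoped Classical

def smallInts (n : ℕ) (X : ℝ) : Set ℂ :=
  {z | ∃ (K : Subfield ℂ) (_ : NumberField K) (a : K), finrank ℚ K ≤ n ∧ IsIntegral ℤ a ∧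
    (∀ φ : K →+* ℂ, ‖φ a‖ ≤ X) ∧ (a : ℂ) = z}

theorem smallInts_finite (n : ℕ) (X : ℝ) : (smallInts n X).Finite := by
  let C := Nat.ceil (max X 1 ^ n * 2 ^ n)
  have := Polynomial.bUnion_roots_finite (algebraMap ℤ ℂ) n (Set.finite_Icc (-C : ℤ) C)
  refine this.subset ?_
  rintro _ ⟨K, _, x, hn, hx1, hx2, rfl⟩
  simp_rw [Set.mem_iUnion]
  have h_map_ℚ_minpoly := minpoly.isIntegrallyClosed_eq_field_fractions' ℚ hx1
  refine ⟨_, ⟨?_, fun i => ?_⟩, Polynomial.mem_rootSet.2 ⟨minpoly.ne_zero hx1, ?_⟩⟩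
  · rw [← (minpoly.monic hx1).natDegree_map (algebraMap ℤ ℚ), ← h_map_ℚ_minpoly]
    exact (minpoly.natDegree_le x).trans hn
  · rw [Set.mem_Icc, ← abs_le, ← @Int.cast_le ℝ]
    refine (Eq.trans_le ?_ <| Embeddings.coeff_bdd_of_norm_le hx2 i).trans (le_trans ?_ (Nat.le_ceil _))
    · rw [h_map_ℚ_minpoly, Polynomial.coeff_map, eq_intCast, Int.norm_cast_rat, Int.norm_eq_abs, Int.cast_abs]
    · have h1 : (1:ℝ) ≤ max X 1 := le_max_right _ _
      gcongr
      · calc ((finrank ℚ K).choose (finrank ℚ K / 2) : ℝ) ≤ ((2 ^ finrank ℚ K : ℕ) : ℝ) := by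
              exact_mod_cast Nat.choose_le_two_pow _ _
          _ = 2 ^ finrank ℚ K := by push_cast; rfl
          _ ≤ 2 ^ n := pow_le_pow_right₀ (by norm_num) hn
  · have h := minpoly.aeval ℤ x
    have h2 := congrArg (algebraMap K ℂ) h
    rw [map_zero, ← Polynomial.aeval_algebraMap_apply] at h2
    exact h2

end mix9

end part9

section part10

open MeasureTheory Module
set_option linter.unusedSectionVars false
set_option linter.unusedSimpArgs false
section mix10
open scoped Classical

theorem dual_normalize {ι : Type} [Fintype ι] (f : (ι → ℝ) →ₗ[ℝ] ℝ) (hf : f ≠ 0) :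
    ∃ (l : (ι → ℝ) →ₗ[ℝ] ℝ) (i : ι), l (Pi.single i 1) = 1 ∧ (∀ x, f x = 0 → l x = 0) ∧
      ∀ x, |l x| ≤ Fintype.card ι * ‖x‖ := by
  have hne : Nonempty ι := by
    by_contra h
    rw [not_nonempty_iff] at h
    exact hf (Subsingleton.elim _ _)
  obtain ⟨i, hi⟩ := Finite.exists_max (fun j => |f (Pi.single j 1)|)
  have hfx : ∀ x, f x = ∑ j, x j * f (Pi.single j 1) := by
    intro x
    conv_lhs => rw [← Finset.univ_sum_single x, map_sum]
    refine Finset.sum_congr rfl fun j _ => ?_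
    have : (Pi.single j (x j) : ι → ℝ) = x j • Pi.single j (1:ℝ) := by
      rw [← Pi.single_smul, smul_eq_mul, mul_one]
    rw [this, map_smul, smul_eq_mul]
  have hi0 : f (Pi.single i 1) ≠ 0 := by
    intro h0
    apply hf
    ext1 j
    ext
    have := hi j
    simp only [h0, abs_zero] at this
    simpa using this
  have hpos : 0 < |f (Pi.single i 1)| := abs_pos.mpr hi0
  refine ⟨(f (Pi.single i 1))⁻¹ • f, i, by simp [hi0], fun x hx => by simp [hx], fun x => ?_⟩
  rw [LinearMap.smul_apply, smul_eq_mul, abs_mul, abs_inv, inv_mul_le_iff₀ hpos, hfx]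
  calc |∑ j, x j * f (Pi.single j 1)| ≤ ∑ j, |x j * f (Pi.single j 1)| := Finset.abs_sum_le_sum_abs _ _
    _ ≤ ∑ _j : ι, ‖x‖ * |f (Pi.single i 1)| := by
        refine Finset.sum_le_sum fun j _ => ?_
        rw [abs_mul]
        exact mul_le_mul (norm_le_pi_norm x j) (hi j) (abs_nonneg _) (norm_nonneg _)
    _ = _ := by simp; ring

theorem lattice_span {ι : Type} [Fintype ι] (L : Submodule ℤ (ι → ℝ)) [DiscreteTopology L]
    [IsZLattice ℝ L] (n : ℕ) (hn : Fintype.card ι ≤ n) (B ε : ℝ) (hε : 0 < ε) (hε1 : ε ≤ 1)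
    (hB : ZLattice.covolume L ≤ B) (hmin : ∀ x ∈ L, x ≠ 0 → ε ≤ ‖x‖) :
    Submodule.span ℝ {x | x ∈ L ∧ ‖x‖ ≤ 1 + (B + 1) / ε ^ n * n} = ⊤ := by
  by_contra hne
  obtain ⟨f, hf, hker⟩ := Submodule.exists_le_ker_of_lt_top _ (lt_top_iff_ne_top.mpr hne)
  obtain ⟨l, i, hl1, hl0, hlb⟩ := dual_normalize f hf
  have hB0 : 0 < B := lt_of_lt_of_le (ZLattice.covolume_pos L) hB
  set lam : ℝ := (B + 1) / ε ^ n with hlam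
  have hen : 0 < ε ^ n := by positivity
  have hen1 : ε ^ n ≤ 1 := pow_le_one₀ hε.le hε1
  have hlam1 : 1 ≤ lam := by
    rw [hlam, le_div_iff₀ hen]; linarith
  let T := LinearMap.transvection ((lam - 1) • l) (Pi.single i (1:ℝ))
  have hT : ∀ x, T x = x + ((lam - 1) * l x) • Pi.single i (1:ℝ) := fun x => by
    simp [T, LinearMap.transvection.apply]
  have hdet : LinearMap.det T = lam := by
    simp [T, LinearMap.transvection.det, hl1]
  have hlT : ∀ x, l (T x) = lam * l x := by
    intro x
    rw [hT, map_add, map_smul, hl1, smul_eq_mul]; ring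
  have hTn : ∀ x, ‖T x‖ ≤ (1 + lam * n) * ‖x‖ := by
    intro x
    rw [hT]
    refine (norm_add_le _ _).trans ?_
    have h1 : ‖(Pi.single i (1:ℝ) : ι → ℝ)‖ ≤ 1 := by
      refine (pi_norm_le_iff_of_nonneg zero_le_one).mpr fun j => ?_
      by_cases h : j = i
      · subst h; simp
      · simp [Pi.single_eq_of_ne h]
    have h2 : ‖((lam - 1) * l x) • (Pi.single i (1:ℝ) : ι → ℝ)‖ ≤ lam * (n * ‖x‖) := by
      rw [norm_smul, Real.norm_eq_abs, abs_mul, abs_of_nonneg (by linarith : 0 ≤ lam - 1)]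
      have h3 : |l x| ≤ n * ‖x‖ := (hlb x).trans (by gcongr)
      calc _ ≤ (lam - 1) * |l x| * 1 := by
            apply mul_le_mul_of_nonneg_left h1
            exact mul_nonneg (by linarith) (abs_nonneg _)
        _ ≤ lam * (n * ‖x‖) := by
            rw [mul_one]
            exact mul_le_mul (by linarith) h3 (abs_nonneg _) (by linarith)
    linarith
  let F := ZSpan.fundamentalDomain ((Free.chooseBasis ℤ L).ofZLatticeBasis ℝ)
  have hF : IsAddFundamentalDomain L F := ZLattice.isAddFundamentalDomain (Free.chooseBasis ℤ L) volume
  have hcov := ZLattice.covolume_eq_measure_fundamentalDomain L volume hF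
  have hFfin : volume F ≠ ⊤ := (ZSpan.fundamentalDomain_isBounded _).measure_lt_top.ne
  have hFle : volume F ≤ ENNReal.ofReal B := by
    rw [← ENNReal.ofReal_toReal hFfin]
    apply ENNReal.ofReal_le_ofReal
    rw [hcov] at hB
    exact hB
  have hvol : volume F * 2 ^ finrank ℝ (ι → ℝ) < volume (T '' Metric.ball 0 ε) := by
    rw [Measure.addHaar_image_linearMap, hdet, Real.volume_pi_ball _ hε, finrank_pi,
      abs_of_pos (by linarith), ← ENNReal.ofReal_mul (by linarith)]
    refine lt_of_le_of_lt (mul_le_mul_left hFle _) ?_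
    have : (2 : ENNReal) ^ Fintype.card ι = ENNReal.ofReal (2 ^ Fintype.card ι) := by
      rw [ENNReal.ofReal_pow (by norm_num)]; simp
    rw [this, ← ENNReal.ofReal_mul hB0.le]
    apply (ENNReal.ofReal_lt_ofReal_iff_of_nonneg (by positivity)).mpr
    rw [mul_pow, mul_comm ((2:ℝ) ^ _), ← mul_assoc]
    apply mul_lt_mul_of_pos_right _ (by positivity)
    have h4 : ε ^ n ≤ ε ^ Fintype.card ι := pow_le_pow_of_le_one hε.le hε1 hn
    calc B < lam * ε ^ n := by rw [hlam, div_mul_cancel₀ _ hen.ne']; linarith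
      _ ≤ _ := by gcongr
  have hsym : ∀ x ∈ T '' Metric.ball 0 ε, -x ∈ T '' Metric.ball 0 ε := by
    rintro _ ⟨y, hy, rfl⟩
    exact ⟨-y, by simpa using hy, by simp⟩
  have hconv : Convex ℝ (T '' Metric.ball 0 ε) := (convex_ball _ _).linear_image T
  have : Countable L.toAddSubgroup := (inferInstance : Countable L)
  obtain ⟨x, hx0, hxs⟩ := exists_ne_zero_mem_lattice_of_measure_mul_two_pow_lt_measure
    (L := L.toAddSubgroup) (μ := volume) (F := F) (s := T '' Metric.ball 0 ε) hF hsym hconv hvol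
  · obtain ⟨y, hy, hyx⟩ := hxs
    rw [mem_ball_zero_iff] at hy
    have hxL : (x : ι → ℝ) ∈ L := x.2
    have hxn : ‖(x : ι → ℝ)‖ ≤ 1 + lam * n := by
      rw [← hyx]
      refine (hTn y).trans ?_
      have : 0 ≤ 1 + lam * n := by positivity
      nlinarith
    have hfx : f x = 0 := hker (Submodule.subset_span ⟨hxL, hxn⟩)
    have h1 := hl0 _ hfx
    rw [← hyx, hlT] at h1
    have h2 : l y = 0 := by
      rcases mul_eq_zero.mp h1 with h | h
      · linarith
      · exact h
    have h3 : T y = y := by rw [hT, h2]; simp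
    rw [h3] at hyx
    have := hmin _ hxL (by simpa using hx0)
    rw [← hyx] at this
    linarith

end mix10

end part10

section part11

open MeasureTheory Module
set_option linter.unusedSectionVars false
set_option linter.unusedSimpArgs false
section mix11
open NumberField NumberField.InfinitePlace NumberField.Units NumberField.Units.dirichletUnitTheorem
open scoped Classical

theorem card_places_le (K : Type) [Field K] [NumberField K] :
    Fintype.card (InfinitePlace K) ≤ finrank ℚ K := by
  have h1 := card_add_two_mul_card_eq_rank K
  have h2 := card_eq_nrRealPlaces_add_nrComplexPlaces K
  omega

theorem unit_mem_smallInts (n : ℕ) (K : Subfield ℂ) [NumberField K] (hn : finrank ℚ K ≤ n)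
    (u : (𝓞 K)ˣ) (r : ℝ) (hr : 0 ≤ r) (h : ‖logEmbedding K (Additive.ofMul u)‖ ≤ r) :
    (((u : 𝓞 K) : K) : ℂ) ∈ smallInts n (Real.exp (n * r)) := by
  refine ⟨K, inferInstance, ((u : 𝓞 K) : K), hn, RingOfIntegers.isIntegral_coe _, fun φ => ?_, rfl⟩
  have h1 := log_le_of_logEmbedding_le hr h (InfinitePlace.mk φ)
  have h2 : Real.log (InfinitePlace.mk φ ((u : 𝓞 K) : K)) ≤ n * r := by
    refine (le_abs_self _).trans (h1.trans ?_)
    gcongr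
    exact (card_places_le K).trans hn
  have h3 : 0 < InfinitePlace.mk φ ((u : 𝓞 K) : K) := by
    rw [InfinitePlace.pos_iff]
    exact coe_ne_zero u
  rw [Real.log_le_iff_le_exp h3] at h2
  exact h2

theorem unit_eps (n : ℕ) : ∃ ε : ℝ, 0 < ε ∧ ε ≤ 1 ∧ ∀ (K : Subfield ℂ) [NumberField K],
    finrank ℚ K ≤ n → ∀ x ∈ unitLattice K, x ≠ 0 → ε ≤ ‖x‖ := by
  set S := smallInts n (Real.exp (n * 1)) with hS
  have hSf : S.Finite := smallInts_finite _ _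
  set N := S.ncard with hN
  refine ⟨1 / (N + 1), by positivity, ?_, ?_⟩
  · rw [div_le_one (by positivity)]
    have : (0:ℝ) ≤ N := Nat.cast_nonneg _
    linarith
  intro K _ hn x hx hx0
  by_contra hlt
  push Not at hlt
  obtain ⟨u, -, hu⟩ := hx
  obtain ⟨u, rfl⟩ := Additive.ofMul.surjective u
  have hpow : ∀ k : ℕ, logEmbedding K (Additive.ofMul (u ^ k)) = (k : ℝ) • x := by
    intro k
    rw [ofMul_pow, map_nsmul, ← hu, Nat.cast_smul_eq_nsmul]
    rfl
  have hmaps : ∀ k ∈ Finset.range (N + 1), (((u ^ k : (𝓞 K)ˣ) : 𝓞 K) : K).1 ∈ hSf.toFinset := by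
    intro k hk
    rw [Set.Finite.mem_toFinset]
    apply unit_mem_smallInts n K hn (u ^ k) 1 zero_le_one
    rw [hpow, norm_smul]
    have hk1 : (k : ℝ) ≤ N := by
      rw [Finset.mem_range] at hk
      exact_mod_cast Nat.lt_succ_iff.mp hk
    rw [Real.norm_of_nonneg (Nat.cast_nonneg _)]
    calc (k:ℝ) * ‖x‖ ≤ (N + 1) * (1 / (N + 1)) := by
          apply mul_le_mul (by linarith) hlt.le (norm_nonneg _) (by positivity)
      _ = 1 := by field_simp
  have hcard := Finset.card_le_card_of_injOn _ hmaps ?_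
  · rw [Finset.card_range, ← Set.ncard_eq_toFinset_card S hSf] at hcard
    omega
  · intro j _ k _ hjk
    have h1 : u ^ j = u ^ k := by
      apply Units.ext
      apply RingOfIntegers.ext
      exact Subtype.ext hjk
    have h2 := hpow j
    rw [h1, hpow k] at h2
    have h3 := smul_left_injective ℝ hx0 h2
    exact_mod_cast h3.symm

theorem units_span (B : ℝ) (n : ℕ) : ∃ X : ℝ, ∀ (K : Subfield ℂ) [NumberField K],
    finrank ℚ K ≤ n → regulator K ≤ B →
    Submodule.span ℝ {x : logSpace K | ∃ u : (𝓞 K)ˣ, (((u : 𝓞 K) : K) : ℂ) ∈ smallInts n X ∧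
      logEmbedding K (Additive.ofMul u) = x} = ⊤ := by
  obtain ⟨ε, h0, h1, hε⟩ := unit_eps n
  refine ⟨Real.exp (n * (1 + (B + 1) / ε ^ n * n)), fun K _ hn hB => ?_⟩
  have hcard : Fintype.card {w : InfinitePlace K // w ≠ w₀} ≤ n :=
    (Fintype.card_subtype_le _).trans ((card_places_le K).trans hn)
  have h := lattice_span (unitLattice K) n hcard B ε h0 h1 hB (hε K hn)
  rw [eq_top_iff, ← h]
  apply Submodule.span_mono
  rintro x ⟨⟨u, -, hu⟩, hxn⟩
  obtain ⟨u, rfl⟩ := Additive.ofMul.surjective u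
  have hB0 : 0 < B := lt_of_lt_of_le (regulator_pos K) hB
  refine ⟨u, ?_, hu⟩
  apply unit_mem_smallInts n K hn u _ (by positivity)
  rw [← hu] at hxn
  exact hxn

theorem rank_le_of_span (F K : Type) [Field F] [NumberField F] [Field K] [NumberField K] [Algebra F K]
    (h : Submodule.span ℝ {x : logSpace K | ∃ u : (𝓞 K)ˣ, (∃ a : F, algebraMap F K a = ((u : 𝓞 K) : K)) ∧
      logEmbedding K (Additive.ofMul u) = x} = ⊤) : rank K ≤ rank F := by
  let ψ : (𝓞 F)ˣ →* (𝓞 K)ˣ := Units.map (algebraMap (𝓞 F) (𝓞 K) : 𝓞 F →* 𝓞 K)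
  let g : (𝓞 F)ˣ → logSpace K := fun v => logEmbedding K (Additive.ofMul (ψ v))
  let f : Fin (rank F) → logSpace K := fun i => g (fundSystem F i)
  have hg : ∀ v, g v ∈ Submodule.span ℝ (Set.range f) := by
    intro v
    obtain ⟨⟨ζ, e⟩, hζ, -⟩ := exist_unique_eq_mul_prod F v
    simp only at hζ
    have h1 : g ζ = 0 := by
      apply logEmbedding_eq_zero_iff.mpr
      have h2 : (ζ : (𝓞 F)ˣ) ∈ CommGroup.torsion _ := ζ.2
      exact (ψ.isOfFinOrder h2)
    have h2 : g v = g ζ + ∑ i, e i • f i := by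
      simp only [g, f]
      rw [hζ, map_mul, map_prod, ofMul_mul, map_add, ofMul_prod, map_sum]
      congr 1
      refine Finset.sum_congr rfl fun i _ => ?_
      rw [map_zpow, ofMul_zpow, map_zsmul]
    rw [h2, h1, zero_add]
    refine Submodule.sum_mem _ fun i _ => ?_
    have hfi : f i ∈ Submodule.span ℝ (Set.range f) := Submodule.subset_span ⟨i, rfl⟩
    exact zsmul_mem hfi _
  have htop : Submodule.span ℝ (Set.range f) = ⊤ := by
    rw [eq_top_iff, ← h, Submodule.span_le]
    rintro _ ⟨u, ⟨a, ha⟩, rfl⟩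
    have hinj := (algebraMap F K).injective
    have hai : IsIntegral ℤ a := by
      rw [← isIntegral_algebraMap_iff (B := K) hinj, ha]
      exact RingOfIntegers.isIntegral_coe _
    have hbi : IsIntegral ℤ a⁻¹ := by
      rw [← isIntegral_algebraMap_iff (B := K) hinj, map_inv₀, ha]
      have : (((u : 𝓞 K) : K))⁻¹ = (((u⁻¹ : (𝓞 K)ˣ) : 𝓞 K) : K) := by
        rw [inv_eq_iff_eq_inv, eq_comm, inv_eq_iff_eq_inv]
        apply eq_inv_of_mul_eq_one_left
        rw [← map_mul]
        simp
      rw [this]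
      exact RingOfIntegers.isIntegral_coe _
    have ha0 : a ≠ 0 := by
      rintro rfl
      rw [map_zero] at ha
      exact coe_ne_zero u ha.symm
    let v : (𝓞 F)ˣ := ⟨⟨a, hai⟩, ⟨a⁻¹, hbi⟩, RingOfIntegers.ext (mul_inv_cancel₀ ha0),
      RingOfIntegers.ext (inv_mul_cancel₀ ha0)⟩
    have hv : ψ v = u := by
      apply Units.ext
      apply RingOfIntegers.ext
      exact ha
    have := hg v
    simp only [g, hv] at this
    exact this
  have h1 := finrank_range_le_card (R := ℝ) f
  rw [Set.finrank, htop, finrank_top, NumberField.Units.finrank_eq_rank, Fintype.card_fin] at h1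
  exact h1

theorem degree_alt (F K : Type) [Field F] [NumberField F] [Field K] [NumberField K] [Algebra F K]
    (h : rank K ≤ rank F) : finrank F K = 1 ∨
      (finrank F K = 2 ∧ nrComplexPlaces F = 0 ∧ nrRealPlaces K = 0) := by
  have h1 := card_add_two_mul_card_eq_rank K
  have h2 := card_eq_nrRealPlaces_add_nrComplexPlaces K
  have h3 := card_add_two_mul_card_eq_rank F
  have h4 := card_eq_nrRealPlaces_add_nrComplexPlaces F
  have h5 : 0 < Fintype.card (InfinitePlace K) := Fintype.card_pos
  have h6 : 0 < Fintype.card (InfinitePlace F) := Fintype.card_pos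
  have h7 : finrank ℚ F * finrank F K = finrank ℚ K := finrank_mul_finrank ℚ F K
  have h8 : 0 < finrank ℚ F := finrank_pos
  have h9 : 0 < finrank F K := finrank_pos
  unfold rank at h
  have h10 : finrank F K ≤ 2 := by
    by_contra hc
    push Not at hc
    have : finrank ℚ F * 3 ≤ finrank ℚ F * finrank F K := Nat.mul_le_mul_left _ hc
    omega
  interval_cases hd : finrank F K
  · left; rfl
  · right
    omega

end mix11

end part11

section part12

open MeasureTheory Module
section mix12
open scoped Classical

theorem numberField_subfield (K : Type) [Field K] [NumberField K] (F : Subfield K) : NumberField F where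
  to_charZero := inferInstance
  to_finiteDimensional := by
    let f : F →ₗ[ℚ] K := (F.subtype.toRatAlgHom).toLinearMap
    exact FiniteDimensional.of_injective f Subtype.val_injective

theorem closure_or_cm (B : ℝ) (n : ℕ) : ∃ X : ℝ, ∀ (K : Subfield ℂ) [NumberField K],
    finrank ℚ K ≤ n → NumberField.Units.regulator K ≤ B → ¬ IsCMField K →
    K = Subfield.closure (smallInts n X ∩ K) := by
  obtain ⟨X, hX⟩ := units_span B n
  refine ⟨X, fun K _ hn hB hcm => ?_⟩
  have hs := hX K hn hB
  let F : Subfield K := Subfield.closure {a : K | (a : ℂ) ∈ smallInts n X}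
  have hF : NumberField F := numberField_subfield K F
  have hrank := rank_le_of_span F K (by
    rw [eq_top_iff, ← hs]
    apply Submodule.span_mono
    rintro x ⟨u, hu, rfl⟩
    exact ⟨u, ⟨⟨_, Subfield.subset_closure hu⟩, rfl⟩, rfl⟩)
  rcases degree_alt F K hrank with h1 | ⟨h2, hc, hr⟩
  · have htop : F = ⊤ := by
      rw [eq_top_iff]
      intro a _
      have hbt := Subalgebra.bot_eq_top_of_finrank_eq_one h1
      have ha : a ∈ (⊥ : Subalgebra F K) := by rw [hbt]; exact Algebra.mem_top
      obtain ⟨b, hb⟩ := Algebra.mem_bot.mp ha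
      rw [← hb]
      exact b.2
    have h3 : (⊤ : Subfield K).map K.subtype = K := by
      ext z
      simp
    rw [← htop] at h3
    conv_lhs => rw [← h3]
    rw [RingHom.map_field_closure]
    congr 1
    ext z
    constructor
    · rintro ⟨a, ha, rfl⟩
      exact ⟨ha, a.2⟩
    · rintro ⟨h4, h5⟩
      exact ⟨⟨z, h5⟩, h4, rfl⟩
  · exfalso
    apply hcm
    refine ⟨fun φ hφ => ?_, F, fun φ => ?_, h2⟩
    · rw [NumberField.InfinitePlace.nrRealPlaces, Fintype.card_eq_zero_iff] at hr
      exact hr.false ⟨NumberField.InfinitePlace.mk φ, φ, hφ, rfl⟩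
    · by_contra hφ
      rw [NumberField.InfinitePlace.nrComplexPlaces, Fintype.card_eq_zero_iff] at hc
      exact hc.false ⟨NumberField.InfinitePlace.mk φ, φ, hφ, rfl⟩

end mix12

end part12

/-- There are only finitely many non-CM number fields (realized as subfields of `ℂ`)
with regulator bounded by a given real number `B`. -/
theorem finite_nonCM_of_bounded_regulator (B : ℝ) :
    {K : Subfield ℂ | ∃ _ : NumberField K,
      ¬ IsCMField K ∧ NumberField.Units.regulator K ≤ B}.Finite := by
  obtain ⟨n, hn⟩ := degree_bound B
  obtain ⟨X, hX⟩ := closure_or_cm B n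
  refine ((smallInts_finite n X).finite_subsets.image Subfield.closure).subset ?_
  rintro K ⟨hK, hcm, hB⟩
  exact ⟨smallInts n X ∩ K, Set.inter_subset_left, (hX K (hn K hB) hB hcm).symm⟩
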